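/- arXiv:2103.15441 — 4 statements merged into one kernel-verified Lean document; each statement's English description precedes it below -/
import Mathlib

section
/- Let ν > 0 and f₀, g₀ ∈ ℝ, and let f : [0,∞) → ℝ be differentiable with f(0) = f₀ and f′(t) = −ν(1 + t²)f(t) − g₀ for all t ≥ 0. Then for all t > 0 it holds that |f(t) − exp(−ν(t + t³/3))·f₀| ≤ (4/(ν(1 + t²)))·|g₀|. -/
noncomputable section

open Real

/-- **Bound on `f` for the viscous traveling wave ODE (α = 0, k = 1).**
If `f′(t) = −ν(1+t²)f(t) − g₀` on `[0,∞)` with `f(0) = f₀`, then for all `t > 0`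
`|f(t) − exp(−ν(t + t³/3))·f₀| ≤ (4/(ν(1+t²)))·|g₀|`. -/
theorem viscous_wave_ode_bound
    (ν f₀ g₀ : ℝ) (hν : 0 < ν) (f : ℝ → ℝ)
    (hf0 : f 0 = f₀)
    (hf : ∀ t ∈ Set.Ici (0 : ℝ),
      HasDerivWithinAt f (-ν * (1 + t ^ 2) * f t - g₀) (Set.Ici (0 : ℝ)) t) :
    ∀ t > (0 : ℝ),
      |f t - Real.exp (-ν * (t + t ^ 3 / 3)) * f₀| ≤ 4 / (ν * (1 + t ^ 2)) * |g₀| := by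
  intro t ht
  set c : ℝ := ν * (1 + t ^ 2) / 3 with hc
  have hc0 : 0 < c := by positivity
  set E : ℝ := exp (ν * (t + t ^ 3 / 3)) with hE
  have hE0 : 0 < E := exp_pos _
  have hexp (s : ℝ) : HasDerivAt (fun s => exp (ν * (s + s ^ 3 / 3)))
      (exp (ν * (s + s ^ 3 / 3)) * (ν * (1 + s ^ 2))) s := by
    have h := (((hasDerivAt_id s).add (((hasDerivAt_id s).pow 3).div_const 3)).const_mul ν).exp
    refine h.congr_deriv ?_
    simp
  have hderiv (s : ℝ) (hs : 0 ≤ s) :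
      HasDerivWithinAt (fun s => exp (ν * (s + s ^ 3 / 3)) * f s - f₀)
        (-g₀ * exp (ν * (s + s ^ 3 / 3))) (Set.Ici 0) s := by
    refine (((hexp s).hasDerivWithinAt.mul (hf s hs)).sub_const f₀).congr_deriv ?_
    ring
  have hB (s : ℝ) : HasDerivAt (fun s => |g₀| * E * exp (c * (s - t)) / c)
      (|g₀| * E * exp (c * (s - t))) s := by
    have h := (((((hasDerivAt_id s).sub_const t).const_mul c).exp).const_mul (|g₀| * E)).div_const c
    refine h.congr_deriv ?_
    simp only [id]
    field_simp
  have key := image_norm_le_of_norm_deriv_right_le_deriv_boundary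
    (a := 0) (b := t)
    (fun s hs => ((hderiv s hs.1).continuousWithinAt).mono Set.Icc_subset_Ici_self)
    (fun s hs => (hderiv s hs.1).mono (Set.Ici_subset_Ici.2 hs.1))
    (by simp only [hf0]; norm_num; positivity) hB
    (by
      rintro s ⟨hs0, hst⟩
      rw [norm_mul, norm_neg, Real.norm_eq_abs, Real.norm_eq_abs, abs_of_pos (exp_pos _),
        mul_assoc, hE, ← exp_add]
      gcongr
      have h : 0 ≤ ν * (t - s) * (2 + t * s + s ^ 2) := by
        have := sub_nonneg.2 hst.le
        positivity
      rw [hc]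
      linarith)
    (Set.right_mem_Icc.2 ht.le)
  simp only [sub_self, mul_zero, exp_zero, mul_one, Real.norm_eq_abs, ← hE] at key
  have hinv : exp (-ν * (t + t ^ 3 / 3)) = E⁻¹ := by rw [hE, ← exp_neg, neg_mul]
  have hfactor : f t - E⁻¹ * f₀ = E⁻¹ * (E * f t - f₀) := by field_simp
  rw [hinv, hfactor, abs_mul, abs_of_pos (inv_pos.2 hE0)]
  calc E⁻¹ * |E * f t - f₀| ≤ E⁻¹ * (|g₀| * E / c) := by gcongr
    _ = 3 / (ν * (1 + t ^ 2)) * |g₀| := by rw [hc]; field_simp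
    _ ≤ 4 / (ν * (1 + t ^ 2)) * |g₀| := by gcongr; norm_num
end
end

section
/- For every ν > 0 and every t > 0 one has ∫₀ᵗ exp(−ν(t − s + t³/3 − s³/3)) ds ≤ 2/(ν(1 + t²/2)). -/
noncomputable section

open Real MeasureTheory intervalIntegral

theorem integral_exp_neg_mul_sub_le {k : ℝ} (hk : 0 < k) (t : ℝ) :
    (∫ s in (0 : ℝ)..t, Real.exp (-k * (t - s))) ≤ 1 / k := by
  have hderiv (s : ℝ) :
      HasDerivAt (fun s => Real.exp (-k * (t - s)) / k) (Real.exp (-k * (t - s))) s := by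
    refine (((((hasDerivAt_id' s).const_sub t).const_mul (-k)).exp).div_const k).congr_deriv ?_
    field_simp
  rw [integral_eq_sub_of_hasDerivAt (fun s _ => hderiv s)
    (Continuous.intervalIntegrable (by fun_prop) _ _)]
  have hpos : 0 ≤ Real.exp (-k * (t - 0)) / k := by positivity
  simpa using hpos

/-- **Duhamel integral bound.** For every `ν > 0` and `t > 0`,
`∫₀ᵗ exp(−ν(t − s + t³/3 − s³/3)) ds ≤ 2/(ν(1 + t²/2))`. -/
theorem duhamel_integral_bound (ν : ℝ) (hν : 0 < ν) (t : ℝ) (ht : 0 < t) :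
    (∫ s in (0 : ℝ)..t, Real.exp (-ν * (t - s + t ^ 3 / 3 - s ^ 3 / 3)))
      ≤ 2 / (ν * (1 + t ^ 2 / 2)) := by
  have hk : 0 < ν * (1 + t ^ 2 / 3) := by positivity
  calc
    _ ≤ ∫ s in (0 : ℝ)..t, Real.exp (-(ν * (1 + t ^ 2 / 3)) * (t - s)) := by
      refine integral_mono_on ht.le (Continuous.intervalIntegrable (by fun_prop) _ _)
        (Continuous.intervalIntegrable (by fun_prop) _ _) fun s hs => Real.exp_le_exp.mpr ?_
      have h : 0 ≤ ν * ((t - s) * (t * s + s ^ 2)) :=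
        mul_nonneg hν.le (mul_nonneg (sub_nonneg.mpr hs.2)
          (add_nonneg (mul_nonneg ht.le hs.1) (sq_nonneg s)))
      linarith
    _ ≤ 1 / (ν * (1 + t ^ 2 / 3)) := integral_exp_neg_mul_sub_le hk t
    _ ≤ 2 / (ν * (1 + t ^ 2 / 2)) := by
      rw [div_le_div_iff₀ hk (by positivity)]
      have h : 0 ≤ ν * t ^ 2 := by positivity
      linarith
end
end

section
/- Let η > 0, let k ≥ 1 be an integer, set t_k = (1/2)(η/(k+1) + η/k), t_0 = 2η, and I_k = (t_k, t_{k−1}). Then for every t ∈ I_k and every l ∈ ℤ with l ≠ 0 and l ≠ k it holds that |t − η/l| ≥ (1/4)·max(η/k², η/l²). -/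
noncomputable section

open Real

/-- The resonant times: `t_k = (1/2)(η/(k+1) + η/k)` for `k ≥ 1` and `t_0 = 2η`.
The `k`-th resonant interval is `I_k = (t_k, t_{k−1})`. -/
def tRes (η : ℝ) (k : ℤ) : ℝ :=
  if k = 0 then 2 * η else (η / ((k : ℝ) + 1) + η / (k : ℝ)) / 2

/-- For `x ≥ 1`, half the gap between `η / x` and `η / (x + 1)` is at least `η / (4 x²)`. -/
theorem quarter_div_sq_le_half_gap {η x : ℝ} (hη : 0 ≤ η) (hx : 1 ≤ x) :
    1 / 4 * (η / x ^ 2) ≤ (η / x - η / (x + 1)) / 2 := by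
  have h : (η / x - η / (x + 1)) / 2 - 1 / 4 * (η / x ^ 2)
      = η * (x - 1) / (4 * x ^ 2 * (x + 1)) := by
    field_simp
    ring
  have h' : 0 ≤ η * (x - 1) / (4 * x ^ 2 * (x + 1)) :=
    div_nonneg (mul_nonneg hη (by linarith)) (by positivity)
  linarith

/-- **Separation of non-resonant critical times.** For `t ∈ I_k` and `l ∉ {0, k}` one has
`|t − η/l| ≥ (1/4)·max(η/k², η/l²)`. -/
theorem nonresonant_time_separation (η : ℝ) (hη : 0 < η) (k : ℤ) (hk : 1 ≤ k) :
    ∀ t ∈ Set.Ioo (tRes η k) (tRes η (k - 1)),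
      ∀ l : ℤ, l ≠ 0 → l ≠ k →
        (1 / 4) * max (η / (k : ℝ) ^ 2) (η / (l : ℝ) ^ 2) ≤ |t - η / (l : ℝ)| := by
  rintro t ⟨hlo, hhi⟩ l hl0 hlk
  have hk' : (1 : ℝ) ≤ k := by exact_mod_cast hk
  rw [tRes, if_neg (by omega)] at hlo
  have hgap := quarter_div_sq_le_half_gap hη.le hk'
  rw [mul_max_of_nonneg _ _ (by norm_num : (0 : ℝ) ≤ 1 / 4)]
  rcases lt_or_gt_of_ne hl0 with hl | hl
  · have hl' : (1 : ℝ) ≤ -l := by exact_mod_cast (by omega : (1 : ℤ) ≤ -l)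
    have hgap_l := quarter_div_sq_le_half_gap hη.le hl'
    rw [neg_sq, div_neg] at hgap_l
    have hk1 : 0 < η / ((k : ℝ) + 1) := by positivity
    have hk0 : 0 < η / (k : ℝ) := by positivity
    have hl1 : 0 < η / (-(l : ℝ) + 1) := by positivity
    have hl2 : η / (l : ℝ) < 0 := div_neg_of_pos_of_neg hη (by linarith)
    exact le_abs.2 (Or.inl (max_le (by linarith) (by linarith)))
  rcases lt_or_gt_of_ne hlk with hlt | hgt
  · have hl' : (1 : ℝ) ≤ l := by exact_mod_cast hl
    have hlk' : (l : ℝ) + 1 ≤ k := by exact_mod_cast hlt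
    rw [tRes, if_neg (by omega)] at hhi
    push_cast at hhi
    rw [sub_add_cancel] at hhi
    have hgap_l := quarter_div_sq_le_half_gap hη.le hl'
    have h1 : η / (k : ℝ) ≤ η / ((l : ℝ) + 1) := by gcongr
    have h2 : η / ((k : ℝ) - 1) ≤ η / (l : ℝ) := by
      gcongr
      linarith
    have h3 : η / (k : ℝ) ^ 2 ≤ η / (l : ℝ) ^ 2 := by gcongr
    exact le_abs.2 (Or.inr (max_le (by linarith) (by linarith)))
  · have hkl' : (k : ℝ) + 1 ≤ l := by exact_mod_cast hgt
    have h1 : η / (l : ℝ) ≤ η / ((k : ℝ) + 1) := by gcongr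
    have h2 : η / (l : ℝ) ^ 2 ≤ η / (k : ℝ) ^ 2 := by gcongr
    exact le_abs.2 (Or.inl (max_le (by linarith) (by linarith)))
end
end

section
/- Assume 0 < c < 0.001. Then every solution (θ, G) of the wave perturbation system with finite X-norms satisfies, in the early time regime 0 < t < η/(8000·cη·π)^{1/3}, the stability estimate 40²·‖θ(t)‖_X + ‖G(t)‖_X ≤ 2·(40²·‖θ(0)‖_X + ‖G(0)‖_X). -/
noncomputable section

open Real MeasureTheory intervalIntegral

/-- The coefficient `c_l^+(t) = cη(l+1)⁻³(1+(η/(l+1)−t)²)⁻²` (zero if `l+1 = 0`). -/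
def cP (c η : ℝ) (l : ℤ) (t : ℝ) : ℝ :=
  if l + 1 = 0 then 0
  else c * η / ((l : ℝ) + 1) ^ 3 * ((1 + (η / ((l : ℝ) + 1) - t) ^ 2) ^ 2)⁻¹

/-- The coefficient `c_l^−(t) = cη(l−1)⁻³(1+(η/(l−1)−t)²)⁻²` (zero if `l−1 = 0`). -/
def cM (c η : ℝ) (l : ℤ) (t : ℝ) : ℝ :=
  if l - 1 = 0 then 0
  else c * η / ((l : ℝ) - 1) ^ 3 * ((1 + (η / ((l : ℝ) - 1) - t) ^ 2) ^ 2)⁻¹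

/-- The coefficient `d_l^+(t) = cη(l+1)⁻³(1+(η/(l+1)−t)²)⁻¹` (zero if `l+1 = 0`). -/
def dP (c η : ℝ) (l : ℤ) (t : ℝ) : ℝ :=
  if l + 1 = 0 then 0
  else c * η / ((l : ℝ) + 1) ^ 3 * (1 + (η / ((l : ℝ) + 1) - t) ^ 2)⁻¹

/-- The coefficient `d_l^−(t) = cη(l−1)⁻³(1+(η/(l−1)−t)²)⁻¹` (zero if `l−1 = 0`). -/
def dM (c η : ℝ) (l : ℤ) (t : ℝ) : ℝ :=
  if l - 1 = 0 then 0
  else c * η / ((l : ℝ) - 1) ^ 3 * (1 + (η / ((l : ℝ) - 1) - t) ^ 2)⁻¹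

/-- Right-hand side of the `θ` equation:
`θ_l′ = c_l⁺θ_{l+1} + c_l⁻θ_{l−1} + d_l⁺G_{l+1} + d_l⁻G_{l−1}`. -/
def thetaRHS (c η : ℝ) (θ G : ℝ → ℤ → ℂ) (l : ℤ) (t : ℝ) : ℂ :=
  (cP c η l t : ℂ) * θ t (l + 1) + (cM c η l t : ℂ) * θ t (l - 1)
    + (dP c η l t : ℂ) * G t (l + 1) + (dM c η l t : ℂ) * G t (l - 1)

/-- Right-hand side of the `G` equation. -/
def GRHS (ν c η : ℝ) (f : ℝ → ℝ) (θ G : ℝ → ℤ → ℂ) (l : ℤ) (t : ℝ) : ℂ :=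
  -((ν * ((l : ℝ) ^ 2 + (η - (l : ℝ) * t) ^ 2) : ℝ) : ℂ) * G t l
    + (f t : ℂ) * (Complex.I * (l : ℂ) / ((2 * c : ℝ) : ℂ)) *
        ((dP c η l t : ℂ) * G t (l + 1) + (dM c η l t : ℂ) * G t (l - 1)
          + (cP c η l t : ℂ) * θ t (l + 1) + (cM c η l t : ℂ) * θ t (l - 1))
    + ((2 * (η / (l : ℝ) - t) * ((1 + (η / (l : ℝ) - t) ^ 2) ^ 2)⁻¹ : ℝ) : ℂ) * θ t l
    + (((1 + (η / (l : ℝ) - t) ^ 2)⁻¹ : ℝ) : ℂ) *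
        ((cP c η l t : ℂ) * θ t (l + 1) + (cM c η l t : ℂ) * θ t (l - 1)
          + (dP c η l t : ℂ) * G t (l + 1) + (dM c η l t : ℂ) * G t (l - 1))

/-- `(θ, G)` is a solution of the wave perturbation system: zero `x`-average modes, and
each nonzero mode satisfies the coupled ODE system. -/
def IsWaveSol (ν c η : ℝ) (f : ℝ → ℝ) (θ G : ℝ → ℤ → ℂ) : Prop :=
  (∀ t, θ t 0 = 0) ∧ (∀ t, G t 0 = 0) ∧
    ∀ l : ℤ, l ≠ 0 → ∀ t : ℝ,
      HasDerivAt (fun s => θ s l) (thetaRHS c η θ G l t) t ∧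
      HasDerivAt (fun s => G s l) (GRHS ν c η f θ G l t) t

/-- The weighted `ℓ²`-norm `‖u‖_X = (∑ λ(l)²|u_l|²)^{1/2}`. -/
def Xnorm (lam : ℤ → ℝ) (u : ℤ → ℂ) : ℝ :=
  Real.sqrt (∑' l : ℤ, (lam l) ^ 2 * ‖u l‖ ^ 2)

/-- Admissible weight: positive with `λ(l±1) < 2λ(l)`. -/
def GoodWeight (lam : ℤ → ℝ) : Prop :=
  (∀ l, 0 < lam l) ∧ (∀ l, lam (l + 1) < 2 * lam l) ∧ (∀ l, lam (l - 1) < 2 * lam l)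

lemma arctan_le_self_of_nonneg {x : ℝ} (hx : 0 ≤ x) : arctan x ≤ x := by
  simpa using le_tan (arctan_nonneg.2 hx) (arctan_lt_pi_div_two x)

lemma arctan_sum_le_div {r T : ℝ} (hr : 1 ≤ r) (hT : 0 < T) :
    arctan (T - r * T) + arctan (r * T) ≤ T / (1 + r * (r - 1) * T ^ 2) := by
  have h0 : 0 ≤ r * (r - 1) * T ^ 2 := by
    have : 0 ≤ r - 1 := by linarith
    positivity
  have h1 : (T - r * T) * (r * T) < 1 := by nlinarith
  rw [arctan_add h1]
  have h2 : (T - r * T + r * T) / (1 - (T - r * T) * (r * T)) = T / (1 + r * (r - 1) * T ^ 2) := by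
    congr 1 <;> ring
  rw [h2]
  exact arctan_le_self_of_nonneg (by positivity)

lemma arctan_sum_le_pi (x T : ℝ) : arctan (T - x) + arctan x ≤ π := by
  linarith [arctan_lt_pi_div_two (T - x), arctan_lt_pi_div_two x]

lemma arctan_sum_le_pi_div_two {x T : ℝ} (h : T ≤ x) : arctan (T - x) + arctan x ≤ π / 2 := by
  have : arctan (T - x) ≤ arctan 0 := arctan_mono (by linarith)
  rw [arctan_zero] at this
  linarith [arctan_lt_pi_div_two x]

lemma cube_mul_arctan_sum_le {r T M : ℝ} (hr : 0 < r) (hT : 0 < T) (hM : 1 ≤ M)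
    (h : 2 * M < r ^ 3 → 1 ≤ r → r ^ 3 * T ≤ M * π * (1 + r * (r - 1) * T ^ 2)) :
    r ^ 3 * (arctan (T - r * T) + arctan (r * T)) ≤ M * π := by
  have hπ := pi_pos
  have hr3 : 0 < r ^ 3 := by positivity
  rcases le_total r 1 with h1 | h1
  · have : r ^ 3 ≤ 1 := pow_le_one₀ hr.le h1
    have hA := arctan_sum_le_pi (r * T) T
    nlinarith
  · rcases le_or_gt (r ^ 3) (2 * M) with h2 | h2
    · have hA := arctan_sum_le_pi_div_two (x := r * T) (T := T) (by nlinarith)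
      nlinarith
    · have hA := arctan_sum_le_div h1 hT
      have hd : 0 < 1 + r * (r - 1) * T ^ 2 := by
        have : 0 ≤ r - 1 := by linarith
        positivity
      calc _ ≤ r ^ 3 * (T / (1 + r * (r - 1) * T ^ 2)) := by gcongr
        _ = r ^ 3 * T / (1 + r * (r - 1) * T ^ 2) := by ring
        _ ≤ M * π := by rw [div_le_iff₀ hd]; exact h h2 h1

lemma pi_mul_le {a b u v : ℝ} (h : u * v ≤ a * 3.1415 * b) (ha : 0 ≤ a) (hb : 0 ≤ b) :
    u * v ≤ a * π * b := by
  refine h.trans ?_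
  have := pi_gt_d4
  gcongr

lemma cube_arctan_le_first {r T : ℝ} (hr : 0 < r) (hT : 0 < T) (h : r ^ 2 ≤ 8 * π * T) :
    r ^ 3 * (arctan (T - r * T) + arctan (r * T)) ≤ 2.25 * π := by
  refine cube_mul_arctan_sum_le hr hT (by norm_num) fun h3 h1 => ?_
  have hT' : r ^ 2 ≤ 25.133 * T := by nlinarith [pi_lt_d4]
  refine pi_mul_le ?_ (by norm_num)
    (by nlinarith [mul_nonneg (mul_nonneg hr.le (sub_nonneg.2 h1)) (sq_nonneg T)])
  have h15 : 1.5 ≤ r := by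
    by_contra! hc
    have : r ^ 3 < 1.5 ^ 3 := pow_lt_pow_left₀ hc hr.le (by norm_num)
    norm_num at this h3; linarith
  rcases le_total r 2.8 with h2 | h2
  · have hd : r ^ 6 ≤ 4 * (2.25 * 3.1415) ^ 2 * (r * (r - 1)) := by
      have : r ^ 5 ≤ 199 * (r - 1) := by
        have e : r ^ 5 = r ^ 4 * r := by ring
        have : r ^ 4 ≤ 61.4656 := by
          calc r ^ 4 ≤ 2.8 ^ 4 := by gcongr
            _ ≤ _ := by norm_num
        nlinarith
      nlinarith
    have hq : 0 < 2.25 * 3.1415 * (r * (r - 1)) := by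
      have : 0 < r - 1 := by linarith
      positivity
    nlinarith [sq_nonneg (2 * (2.25 * 3.1415 * (r * (r - 1))) * T - r ^ 3)]
  · obtain ⟨u, hu, rfl⟩ : ∃ u, 0 ≤ u ∧ T = r ^ 2 / 25.133 + u :=
      ⟨T - r ^ 2 / 25.133, by rw [sub_nonneg, div_le_iff₀ (by norm_num)]; linarith, by ring⟩
    have e1 : 0 ≤ u * (r ^ 3 * (0.5622 * (r - 1) - 1)) := by
      have : 0 ≤ 0.5622 * (r - 1) - 1 := by linarith
      positivity
    have e2 : 0 ≤ r * (r - 1) * u ^ 2 := by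
      have : 0 ≤ r - 1 := by linarith
      positivity
    have e3 : 0 ≤ u * (r ^ 3 * (r - 1)) := by
      have : 0 ≤ r - 1 := by linarith
      positivity
    have e4 : 0 ≤ r ^ 5 * (0.01118 * (r - 1) - 0.0398) + 7.068 := by
      nlinarith [mul_nonneg (pow_nonneg hr.le 4) (sq_nonneg (r - 3.8)),
        mul_nonneg (pow_nonneg hr.le 3) (sq_nonneg (r - 3.8)),
        mul_nonneg (pow_nonneg hr.le 2) (sq_nonneg (r - 3.8)),
        mul_nonneg hr.le (sq_nonneg (r - 3.8)), sq_nonneg (r - 3.8)]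
    have e5 : 0 ≤ r ^ 5 * (r - 1) := by
      have : 0 ≤ r - 1 := by linarith
      positivity
    have e6 : 0 ≤ r ^ 5 := by positivity
    norm_num at *
    ring_nf at *
    nlinarith

lemma cube_arctan_le_first_late {r T : ℝ} (hr : 0 < r) (hT : 0.93 ≤ T) (h : r ^ 2 ≤ 8 * π * T) :
    r ^ 3 * (arctan (T - r * T) + arctan (r * T)) ≤ 2 * π := by
  refine cube_mul_arctan_sum_le hr (by linarith) (by norm_num) fun h3 h1 => ?_
  have hT' : r ^ 2 ≤ 25.133 * T := by nlinarith [pi_lt_d4]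
  refine pi_mul_le ?_ (by norm_num)
    (by nlinarith [mul_nonneg (mul_nonneg hr.le (sub_nonneg.2 h1)) (sq_nonneg T)])
  have h15 : 1.5 ≤ r := by
    by_contra! hc
    have : r ^ 3 < 1.5 ^ 3 := pow_lt_pow_left₀ hc hr.le (by norm_num)
    norm_num at this h3; linarith
  have hr1 : 0 ≤ r - 1 := by linarith
  rcases le_total r 4.835 with h2 | h2
  · obtain ⟨u, hu, rfl⟩ : ∃ u, 0 ≤ u ∧ T = 0.93 + u := ⟨T - 0.93, by linarith, by ring⟩
    have e1 : 0 ≤ 6.283 * (1 + r * (r - 1) * 0.93 ^ 2) - r ^ 3 * 0.93 := by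
      nlinarith [mul_nonneg (sub_nonneg.2 h2) (mul_nonneg hr.le hr1),
        mul_nonneg (sub_nonneg.2 h2) hr1,
        mul_nonneg (sub_nonneg.2 h2) hr.le]
    have e2 : 0 ≤ u * (r * (11.686 * (r - 1) - r ^ 2)) := by
      have : 0 ≤ 11.686 * (r - 1) - r ^ 2 := by nlinarith
      positivity
    have e3 : 0 ≤ r * (r - 1) * u ^ 2 := by positivity
    have e4 : 0 ≤ u * (r * (r - 1)) := by positivity
    nlinarith
  · obtain ⟨u, hu, rfl⟩ : ∃ u, 0 ≤ u ∧ T = r ^ 2 / 25.133 + u :=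
      ⟨T - r ^ 2 / 25.133, by rw [sub_nonneg, div_le_iff₀ (by norm_num)]; linarith, by ring⟩
    have e1 : 0 ≤ u * (r ^ 3 * (0.4999 * (r - 1) - 1)) := by
      have : 0 ≤ 0.4999 * (r - 1) - 1 := by linarith
      positivity
    have e2 : 0 ≤ r * (r - 1) * u ^ 2 := by positivity
    have e3 : 0 ≤ u * (r ^ 3 * (r - 1)) := by positivity
    have e4 : 0 ≤ r ^ 5 * (0.009946 * (r - 1) - 0.03979) + 6.283 := by
      rcases le_total (0.03979 : ℝ) (0.009946 * (r - 1)) with h5 | h5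
      · have : 0 ≤ 0.009946 * (r - 1) - 0.03979 := by linarith
        positivity
      · have : r ^ 5 ≤ 5.002 ^ 5 := by
          gcongr
          linarith
        norm_num at *
        nlinarith
    have e5 : 0 ≤ r ^ 5 * (r - 1) := by positivity
    have e6 : 0 ≤ r ^ 5 := by positivity
    norm_num at *
    ring_nf at *
    nlinarith

lemma cube_arctan_le_second {r T : ℝ} (hr : 0 < r) (hT : 0 < T) (h : 4 * r ^ 2 ≤ 8 * π * T) :
    r ^ 3 * (arctan (T - r * T) + arctan (r * T)) ≤ 1.35 * π := by
  refine cube_mul_arctan_sum_le hr hT (by norm_num) fun h3 h1 => ?_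
  have hT' : r ^ 2 ≤ 6.2833 * T := by nlinarith [pi_lt_d4]
  refine pi_mul_le ?_ (by norm_num)
    (by nlinarith [mul_nonneg (mul_nonneg hr.le (sub_nonneg.2 h1)) (sq_nonneg T)])
  have h15 : 1.38 ≤ r := by
    by_contra! hc
    have : r ^ 3 < 1.38 ^ 3 := pow_lt_pow_left₀ hc hr.le (by norm_num)
    norm_num at this h3; linarith
  have hr1 : 0 < r - 1 := by linarith
  rcases le_total r 2.5 with h2 | h2
  · have hd : r ^ 6 ≤ 4 * (1.35 * 3.1415) ^ 2 * (r * (r - 1)) := by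
      have : r ^ 5 ≤ 71.9 * (r - 1) := by
        have e : r ^ 5 = r ^ 3 * r ^ 2 := by ring
        have : r ^ 3 ≤ 15.625 := by
          calc r ^ 3 ≤ 2.5 ^ 3 := by gcongr
            _ ≤ _ := by norm_num
        have h7 : r ^ 2 ≤ 3.88 * r - 3.45 := by nlinarith
        nlinarith
      nlinarith
    have hq : 0 < 1.35 * 3.1415 * (r * (r - 1)) := by positivity
    nlinarith [sq_nonneg (2 * (1.35 * 3.1415 * (r * (r - 1))) * T - r ^ 3)]
  · have e1 : r ^ 3 * T ≤ 4.241 * (r * (r - 1)) * T ^ 2 := by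
      have : r ^ 2 ≤ 4.241 * (r - 1) * T := by nlinarith
      nlinarith [mul_le_mul_of_nonneg_left this (mul_pos hr hT).le]
    nlinarith [mul_nonneg (mul_nonneg hr.le hr1.le) (sq_nonneg T)]

lemma cube_arctan_le_third {r T : ℝ} (hr : 0 < r) (hT : 0 < T) (h : 9 * r ^ 2 ≤ 8 * π * T) :
    r ^ 3 * (arctan (T - r * T) + arctan (r * T)) ≤ π := by
  rw [← one_mul π]
  refine cube_mul_arctan_sum_le hr hT (by norm_num) fun h3 h1 => ?_
  have hT' : r ^ 2 ≤ 2.7926 * T := by nlinarith [pi_lt_d4]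
  refine pi_mul_le ?_ (by norm_num)
    (by nlinarith [mul_nonneg (mul_nonneg hr.le (sub_nonneg.2 h1)) (sq_nonneg T)])
  have h15 : 1.25 ≤ r := by
    by_contra! hc
    have : r ^ 3 < 1.25 ^ 3 := pow_lt_pow_left₀ hc hr.le (by norm_num)
    norm_num at this h3; linarith
  have hr1 : 0 < r - 1 := by linarith
  rcases le_total r 2 with h2 | h2
  · have hd : r ^ 6 ≤ 4 * (1 * 3.1415) ^ 2 * (r * (r - 1)) := by
      have : r ^ 5 ≤ 39.4 * (r - 1) := by
        have e : r ^ 5 = r ^ 3 * r ^ 2 := by ring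
        have : r ^ 3 ≤ 8 := by
          calc r ^ 3 ≤ 2 ^ 3 := by gcongr
            _ ≤ _ := by norm_num
        have h7 : r ^ 2 ≤ 3.25 * r - 2.5 := by nlinarith
        nlinarith
      nlinarith
    have hq : 0 < 1 * 3.1415 * (r * (r - 1)) := by positivity
    nlinarith [sq_nonneg (2 * (1 * 3.1415 * (r * (r - 1))) * T - r ^ 3)]
  · have e1 : r ^ 3 * T ≤ 3.1415 * (r * (r - 1)) * T ^ 2 := by
      have : r ^ 2 ≤ 3.1415 * (r - 1) * T := by nlinarith
      nlinarith [mul_le_mul_of_nonneg_left this (mul_pos hr hT).le]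
    nlinarith [mul_nonneg (mul_nonneg hr.le hr1.le) (sq_nonneg T)]

lemma cube_arctan_le_third_early {r T : ℝ} (hr : 0 < r) (hT : 0 < T) (hT1 : T ≤ 0.93)
    (h : 9 * r ^ 2 ≤ 8 * π * T) :
    r ^ 3 * (arctan (T - r * T) + arctan (r * T)) ≤ 0.67 * π := by
  have hT' : r ^ 2 ≤ 2.7926 * T := by nlinarith [pi_lt_d4]
  have hπ := pi_gt_d4
  rcases le_total r 1 with h1 | h1
  · have hA : arctan (T - r * T) + arctan (r * T) ≤ T := by
      have a1 : arctan (T - r * T) ≤ T - r * T := arctan_le_self_of_nonneg (by nlinarith)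
      have a2 : arctan (r * T) ≤ r * T := arctan_le_self_of_nonneg (by positivity)
      linarith
    have h3 : r ^ 3 ≤ 1 := pow_le_one₀ hr.le h1
    have : 0 < r ^ 3 := by positivity
    nlinarith
  · have hA := arctan_sum_le_div h1 hT
    have hr1 : 0 ≤ r - 1 := by linarith
    have hd : 0 < 1 + r * (r - 1) * T ^ 2 := by positivity
    calc _ ≤ r ^ 3 * (T / (1 + r * (r - 1) * T ^ 2)) := by gcongr
      _ = r ^ 3 * T / (1 + r * (r - 1) * T ^ 2) := by ring
      _ ≤ 0.67 * π := by
        rw [div_le_iff₀ hd]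
        refine pi_mul_le ?_ (by norm_num) hd.le
        have hr2 : r ≤ 1.6116 := by nlinarith
        obtain ⟨u, hu, rfl⟩ : ∃ u, 0 ≤ u ∧ T = 0.93 - u := ⟨0.93 - T, by linarith, by ring⟩
        have e1 : 0 ≤ 2.1048 * (1 + r * (r - 1) * 0.93 ^ 2) - r ^ 3 * 0.93 := by
          nlinarith [mul_nonneg (sub_nonneg.2 hr2) (mul_nonneg hr.le hr1),
            mul_nonneg (sub_nonneg.2 hr2) hr1,
            mul_nonneg (sub_nonneg.2 hr2) hr.le]
        have e2 : 0 ≤ u * (r * (r ^ 2 - 3.915 * (r - 1))) := by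
          have : 0 ≤ r ^ 2 - 3.915 * (r - 1) := by nlinarith [sq_nonneg (r - 1.9575)]
          positivity
        have e3 : 0 ≤ r * (r - 1) * u ^ 2 := by positivity
        have e4 : 0 ≤ u * (r * (r - 1)) := by positivity
        nlinarith

/-- The `ℓ²` norm of a real sequence indexed by `ℤ`. -/
noncomputable def l2norm (u : ℤ → ℝ) : ℝ := √(∑' l, u l ^ 2)

lemma l2norm_nonneg (u : ℤ → ℝ) : 0 ≤ l2norm u := sqrt_nonneg _

lemma summable_sq_of_le {u v : ℤ → ℝ} (hu : ∀ l, 0 ≤ u l) (huv : ∀ l, u l ≤ v l)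
    (hv : Summable fun l => v l ^ 2) : Summable fun l => u l ^ 2 :=
  hv.of_nonneg_of_le (fun _ => sq_nonneg _) fun l => pow_le_pow_left₀ (hu l) (huv l) 2

lemma l2norm_mono {u v : ℤ → ℝ} (hu : ∀ l, 0 ≤ u l) (huv : ∀ l, u l ≤ v l)
    (hv : Summable fun l => v l ^ 2) : l2norm u ≤ l2norm v :=
  sqrt_le_sqrt <| (summable_sq_of_le hu huv hv).tsum_le_tsum
    (fun l => pow_le_pow_left₀ (hu l) (huv l) 2) hv

lemma l2norm_add_le {u v : ℤ → ℝ} (hu : ∀ l, 0 ≤ u l) (hv : ∀ l, 0 ≤ v l)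
    (hus : Summable fun l => u l ^ 2) (hvs : Summable fun l => v l ^ 2) :
    (Summable fun l => (u l + v l) ^ 2) ∧
      l2norm (fun l => u l + v l) ≤ l2norm u + l2norm v := by
  have h := Real.Lp_add_le_tsum_of_nonneg (p := 2) (by norm_num) hu hv
    (by exact_mod_cast hus) (by exact_mod_cast hvs)
  simp only [l2norm, sqrt_eq_rpow]
  exact_mod_cast h

lemma l2norm_const_mul {a : ℝ} (ha : 0 ≤ a) (u : ℤ → ℝ) :
    l2norm (fun l => a * u l) = a * l2norm u := by
  simp only [l2norm, mul_pow, tsum_mul_left]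
  rw [sqrt_mul (sq_nonneg a), sqrt_sq ha]

/-- The weighted nearest-neighbour coupling operator, with the zero mode removed. -/
noncomputable def hop (w u : ℤ → ℝ) (l : ℤ) : ℝ :=
  if l = 0 then 0 else w (l + 1) * u (l + 1) + w (l - 1) * u (l - 1)

lemma hop_nonneg {w u : ℤ → ℝ} (hw : ∀ j, 0 ≤ w j) (hu : ∀ j, 0 ≤ u j) (l : ℤ) :
    0 ≤ hop w u l := by
  unfold hop
  split_ifs
  · rfl
  · exact add_nonneg (mul_nonneg (hw _) (hu _)) (mul_nonneg (hw _) (hu _))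

/-- Young weight attached to the transfer from mode `j` to mode `j - 1`. -/
noncomputable def youngWeight (ε : ℝ) (j : ℤ) : ℝ :=
  if j = 1 then 0 else if j = 2 then 1 else if j = 3 then 1 + 1 / ε
    else if j = -1 then 1 + ε else 2

lemma youngWeight_nonneg {ε : ℝ} (hε : 0 < ε) (j : ℤ) : 0 ≤ youngWeight ε j := by
  unfold youngWeight
  split_ifs <;> positivity

lemma add_sq_le_young {ε : ℝ} (hε : 0 < ε) (a b : ℝ) :
    (a + b) ^ 2 ≤ (1 + 1 / ε) * a ^ 2 + (1 + ε) * b ^ 2 := by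
  have : (1 + 1 / ε) * a ^ 2 + (1 + ε) * b ^ 2 - (a + b) ^ 2 = (a - ε * b) ^ 2 / ε := by
    field_simp
    ring
  have : 0 ≤ (a - ε * b) ^ 2 / ε := by positivity
  linarith

lemma hop_sq_le {w u : ℤ → ℝ} {ε : ℝ} (hε : 0 < ε) (hu0 : u 0 = 0) (l : ℤ) :
    hop w u l ^ 2 ≤ youngWeight ε (l + 1) * (w (l + 1) * u (l + 1)) ^ 2
      + youngWeight ε (-(l - 1)) * (w (l - 1) * u (l - 1)) ^ 2 := by
  have key : ∀ a b : ℝ, (a + b) ^ 2 ≤ 2 * a ^ 2 + 2 * b ^ 2 := fun a b => by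
    nlinarith [sq_nonneg (a - b)]
  have hnn := youngWeight_nonneg hε
  by_cases h0 : l = 0
  · simp only [hop, h0, if_true]
    rw [zero_pow two_ne_zero]
    exact add_nonneg (mul_nonneg (hnn _) (sq_nonneg _)) (mul_nonneg (hnn _) (sq_nonneg _))
  simp only [hop, h0, if_false]
  by_cases h1 : l = 1
  · subst h1
    simp [hu0, youngWeight]
  by_cases h2 : l = -1
  · subst h2
    simp [hu0, youngWeight]
  by_cases h3 : l = 2
  · subst h3
    simpa [youngWeight] using add_sq_le_young hε (w (2 + 1) * u (2 + 1)) (w (2 - 1) * u (2 - 1))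
  by_cases h4 : l = -2
  · subst h4
    have := add_sq_le_young hε (w (-2 - 1) * u (-2 - 1)) (w (-2 + 1) * u (-2 + 1))
    norm_num [youngWeight] at this ⊢
    linarith
  have e1 : youngWeight ε (l + 1) = 2 := by
    unfold youngWeight
    split_ifs <;> first | omega | rfl
  have e2 : youngWeight ε (-(l - 1)) = 2 := by
    unfold youngWeight
    split_ifs <;> first | omega | rfl
  rw [e1, e2]
  exact key _ _

/-- Bounds on the coupling weights under which `hop w` has `ℓ²` operator norm at most `K`. -/
structure HopBound (w : ℤ → ℝ) (K : ℝ) : Prop where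
  nonneg : ∀ j, 0 ≤ w j
  bound : ∃ ε p q r : ℝ, 0 < ε ∧ ε ≤ 1 ∧ (∀ j : ℤ, |j| = 1 → w j ≤ p) ∧
    (∀ j : ℤ, |j| = 2 → w j ≤ q) ∧ (∀ j : ℤ, 3 ≤ |j| → w j ≤ r) ∧
    (1 + ε) * p ^ 2 ≤ K ^ 2 ∧ 3 * q ^ 2 ≤ K ^ 2 ∧ (3 + 1 / ε) * r ^ 2 ≤ K ^ 2

lemma HopBound.youngWeight_mul_le {w : ℤ → ℝ} {K : ℝ} (hw : HopBound w K) :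
    ∃ ε, 0 < ε ∧ ∀ j, j ≠ 0 →
      (youngWeight ε j + youngWeight ε (-j)) * w j ^ 2 ≤ K ^ 2 := by
  obtain ⟨hw0, ε, p, q, r, hε, hε1, hp, hq, hr, hpK, hqK, hrK⟩ := hw
  refine ⟨ε, hε, fun j h0 => ?_⟩
  rcases lt_trichotomy |j| 2 with h | h | h
  · have h1 : |j| = 1 := by have := abs_pos.2 h0; omega
    have e : youngWeight ε j + youngWeight ε (-j) = 1 + ε := by
      rcases (abs_eq (by norm_num)).1 h1 with rfl | rfl <;> norm_num [youngWeight]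
    rw [e]
    refine le_trans ?_ hpK
    gcongr
    exacts [hw0 j, hp j h1]
  · have e : youngWeight ε j + youngWeight ε (-j) = 3 := by
      rcases (abs_eq (by norm_num)).1 h with rfl | rfl <;> norm_num [youngWeight]
    rw [e]
    refine le_trans ?_ hqK
    gcongr
    exacts [hw0 j, hq j h]
  · have hε' : 1 ≤ 1 / ε := by rw [le_div_iff₀ hε]; linarith
    have e : youngWeight ε j + youngWeight ε (-j) ≤ 3 + 1 / ε := by
      have : j ≠ 1 ∧ j ≠ 2 ∧ j ≠ -1 ∧ j ≠ -2 := by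
        refine ⟨?_, ?_, ?_, ?_⟩ <;> rintro rfl <;> norm_num at h
      unfold youngWeight
      split_ifs <;> first | omega | linarith
    refine le_trans ?_ hrK
    gcongr
    exacts [hw0 j, hr j (by omega)]

lemma tsum_shift_add_shift {a b : ℤ → ℝ} (ha : Summable a) (hb : Summable b) :
    (Summable fun l => a (l + 1) + b (l - 1)) ∧
      ∑' l, (a (l + 1) + b (l - 1)) = ∑' l, (a l + b l) := by
  have h := ((Equiv.addRight (1 : ℤ)).hasSum_iff.2 ha.hasSum).add
    ((Equiv.subRight (1 : ℤ)).hasSum_iff.2 hb.hasSum)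
  exact ⟨h.summable, h.tsum_eq.trans (ha.tsum_add hb).symm⟩

lemma l2norm_hop_le {w u : ℤ → ℝ} {K : ℝ} (hK : 0 ≤ K) (hw : HopBound w K) (hu0 : u 0 = 0)
    (hus : Summable fun l => u l ^ 2) :
    (Summable fun l => hop w u l ^ 2) ∧ l2norm (hop w u) ≤ K * l2norm u := by
  obtain ⟨ε, hε, hj'⟩ := hw.youngWeight_mul_le
  have hle := hop_sq_le (w := w) hε hu0
  obtain ⟨a, ha⟩ : ∃ a : ℤ → ℝ, ∀ j, a j = youngWeight ε j * (w j * u j) ^ 2 := ⟨_, fun _ => rfl⟩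
  obtain ⟨b, hb⟩ : ∃ b : ℤ → ℝ, ∀ j, b j = youngWeight ε (-j) * (w j * u j) ^ 2 :=
    ⟨_, fun _ => rfl⟩
  have ha0 : ∀ j, 0 ≤ a j := fun j => by
    rw [ha]
    exact mul_nonneg (youngWeight_nonneg hε _) (sq_nonneg _)
  have hb0 : ∀ j, 0 ≤ b j := fun j => by
    rw [hb]
    exact mul_nonneg (youngWeight_nonneg hε _) (sq_nonneg _)
  have hj : ∀ j, a j + b j ≤ K ^ 2 * u j ^ 2 := fun j => by
    rw [ha, hb]
    by_cases h0 : j = 0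
    · simp [h0, hu0]
    calc _ = (youngWeight ε j + youngWeight ε (-j)) * w j ^ 2 * u j ^ 2 := by ring
      _ ≤ _ := mul_le_mul_of_nonneg_right (hj' j h0) (sq_nonneg _)
  simp only [← ha, ← hb] at hle
  have hs := hus.mul_left (K ^ 2)
  have has : Summable a := hs.of_nonneg_of_le ha0 fun j => by linarith [hj j, hb0 j]
  have hbs : Summable b := hs.of_nonneg_of_le hb0 fun j => by linarith [hj j, ha0 j]
  obtain ⟨hab, htsum⟩ := tsum_shift_add_shift has hbs
  have hsum : Summable fun l => hop w u l ^ 2 :=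
    hab.of_nonneg_of_le (fun _ => sq_nonneg _) hle
  refine ⟨hsum, ?_⟩
  have : ∑' l, hop w u l ^ 2 ≤ K ^ 2 * ∑' l, u l ^ 2 := by
    calc _ ≤ ∑' l, (a (l + 1) + b (l - 1)) := hsum.tsum_le_tsum hle hab
      _ = ∑' l, (a l + b l) := htsum
      _ ≤ ∑' l, K ^ 2 * u l ^ 2 := (has.add hbs).tsum_le_tsum hj hs
      _ = _ := tsum_mul_left
  calc l2norm (hop w u) ≤ √(K ^ 2 * ∑' l, u l ^ 2) := sqrt_le_sqrt this
    _ = K * l2norm u := by rw [sqrt_mul (sq_nonneg K), sqrt_sq hK]; rfl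

lemma l2norm_system_le {w b h g h0 g0 : ℤ → ℝ} (hw : HopBound w 0.949) (hb : HopBound b 0.0205)
    (hh : ∀ l, 0 ≤ h l) (hg : ∀ l, 0 ≤ g l) (hh0 : ∀ l, 0 ≤ h0 l) (hg0 : ∀ l, 0 ≤ g0 l)
    (hhz : h 0 = 0) (hgz : g 0 = 0)
    (hhs : Summable fun l => h l ^ 2) (hgs : Summable fun l => g l ^ 2)
    (hh0s : Summable fun l => h0 l ^ 2) (hg0s : Summable fun l => g0 l ^ 2)
    (hhle : ∀ l, l ≠ 0 → h l ≤ h0 l + hop w g l + 1 / 1600 * hop w h l)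
    (hgle : ∀ l, l ≠ 0 →
      g l ≤ g0 l + hop b g l + 1 / 1600 * hop b h l + π / 1600 * h l) :
    l2norm h + l2norm g ≤ 2 * (l2norm h0 + l2norm g0) := by
  have hπ := pi_pos
  have smul : ∀ {a : ℝ} {u : ℤ → ℝ}, (Summable fun l => u l ^ 2) →
      Summable fun l => (a * u l) ^ 2 := fun {a u} hu => by
    simpa only [mul_pow] using hu.mul_left (a ^ 2)
  obtain ⟨wgs, wg⟩ := l2norm_hop_le (by norm_num) hw hgz hgs
  obtain ⟨whs, wh⟩ := l2norm_hop_le (by norm_num) hw hhz hhs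
  obtain ⟨bgs, bg⟩ := l2norm_hop_le (by norm_num) hb hgz hgs
  obtain ⟨bhs, bh⟩ := l2norm_hop_le (by norm_num) hb hhz hhs
  have wg0 := hop_nonneg hw.nonneg hg
  have wh0 := hop_nonneg hw.nonneg hh
  have bg0 := hop_nonneg hb.nonneg hg
  have bh0 := hop_nonneg hb.nonneg hh
  have H : l2norm h ≤ l2norm h0 + 0.949 * l2norm g + 1 / 1600 * (0.949 * l2norm h) := by
    obtain ⟨s1, n1⟩ := l2norm_add_le hh0 wg0 hh0s wgs
    obtain ⟨s2, n2⟩ := l2norm_add_le (fun l => add_nonneg (hh0 l) (wg0 l))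
      (fun l => mul_nonneg (by norm_num : (0 : ℝ) ≤ 1 / 1600) (wh0 l)) s1 (smul whs)
    rw [l2norm_const_mul (by norm_num)] at n2
    have n3 := l2norm_mono hh (fun l => ?_) s2
    · linarith
    · rcases eq_or_ne l 0 with rfl | hl
      · rw [hhz]
        exact add_nonneg (add_nonneg (hh0 _) (wg0 _)) (mul_nonneg (by norm_num) (wh0 _))
      · exact hhle l hl
  have G : l2norm g ≤ l2norm g0 + 0.0205 * l2norm g + 1 / 1600 * (0.0205 * l2norm h)
      + π / 1600 * l2norm h := by
    obtain ⟨s1, n1⟩ := l2norm_add_le hg0 bg0 hg0s bgs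
    have p2 := fun l => mul_nonneg (by norm_num : (0 : ℝ) ≤ 1 / 1600) (bh0 l)
    have p3 := fun l => mul_nonneg (by positivity : (0 : ℝ) ≤ π / 1600) (hh l)
    have p1 := fun l => add_nonneg (hg0 l) (bg0 l)
    obtain ⟨s2, n2⟩ := l2norm_add_le p1 p2 s1 (smul bhs)
    obtain ⟨s3, n3⟩ := l2norm_add_le (fun l => add_nonneg (p1 l) (p2 l)) p3 s2 (smul hhs)
    rw [l2norm_const_mul (by norm_num)] at n2
    rw [l2norm_const_mul (by positivity)] at n3
    have n4 := l2norm_mono hg (fun l => ?_) s3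
    · linarith
    · rcases eq_or_ne l 0 with rfl | hl
      · rw [hgz]
        exact add_nonneg (add_nonneg (p1 _) (p2 _)) (p3 _)
      · exact hgle l hl
  have := l2norm_nonneg h
  have := l2norm_nonneg g
  have := l2norm_nonneg h0
  have := l2norm_nonneg g0
  have : π / 1600 * l2norm h ≤ 3.1416 / 1600 * l2norm h := by
    have := pi_lt_d4
    gcongr
  linarith

/-- The amplitude of the resonance of mode `j`. -/
noncomputable def resAmp (c η : ℝ) (j : ℤ) : ℝ := c * η / |(j : ℝ)| ^ 3

/-- The (absolute) resonant time of mode `j`. -/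
noncomputable def resTime (η : ℝ) (j : ℤ) : ℝ := η / |(j : ℝ)|

/-- The integral over `[0, t]` of the resonance profile of mode `j`. -/
noncomputable def resInt (c η t : ℝ) (j : ℤ) : ℝ :=
  resAmp c η j * (arctan (t - resTime η j) + arctan (resTime η j))

/-- A bound for the total feedback of mode `j` into the `G` equation up to time `t`. -/
noncomputable def feedbackInt (c η t : ℝ) (j : ℤ) : ℝ :=
  c * (|(j : ℝ)| + 1) / |(j : ℝ)| ^ 2 * (3 * π / 2) + resInt c η t j

lemma resAmp_nonneg {c η : ℝ} (hc : 0 < c) (hη : 0 < η) (j : ℤ) : 0 ≤ resAmp c η j := by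
  unfold resAmp
  positivity

lemma resInt_mono {c η s t : ℝ} (hc : 0 < c) (hη : 0 < η) (hst : s ≤ t) (j : ℤ) :
    resInt c η s j ≤ resInt c η t j := by
  unfold resInt
  have := resAmp_nonneg hc hη j
  have := arctan_mono (sub_le_sub_right hst (resTime η j))
  gcongr

lemma resInt_nonneg {c η t : ℝ} (hc : 0 < c) (hη : 0 < η) (ht : 0 ≤ t) (j : ℤ) :
    0 ≤ resInt c η t j := by
  refine le_trans ?_ (resInt_mono hc hη ht j)
  simp [resInt, arctan_neg]

lemma feedbackInt_nonneg {c η t : ℝ} (hc : 0 < c) (hη : 0 < η) (ht : 0 ≤ t) (j : ℤ) :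
    0 ≤ feedbackInt c η t j := by
  have := resInt_nonneg hc hη ht j
  have := pi_pos
  unfold feedbackInt
  positivity

lemma resInt_le {c η T M : ℝ} (hη : 0 < η) (hT : 0 < T)
    (hTη : 8000 * π * c * T ^ 3 = η ^ 2) (hc' : c < 0.001) {j : ℤ} (hj : j ≠ 0) {n : ℝ}
    (hn : 0 ≤ n) (hnj : n ≤ |(j : ℝ)|)
    (h : ∀ r : ℝ, 0 < r → n ^ 2 * r ^ 2 ≤ 8 * π * T →
      r ^ 3 * (arctan (T - r * T) + arctan (r * T)) ≤ M * π) :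
    resInt c η T j ≤ M / 8000 := by
  have hj' : 0 < |(j : ℝ)| := abs_pos.2 (Int.cast_ne_zero.2 hj)
  have hπ := pi_pos
  obtain ⟨r, hr⟩ : ∃ r, r = resTime η j / T := ⟨_, rfl⟩
  have hrpos : 0 < r := by
    rw [hr, resTime]
    positivity
  have hrT : resTime η j = r * T := by
    rw [hr]
    field_simp
  have hη' : η = r * T * |(j : ℝ)| := by
    rw [← hrT, resTime]
    field_simp
  have hr2 : n ^ 2 * r ^ 2 ≤ 8 * π * T := by
    have h1 : (r * T * |(j : ℝ)|) ^ 2 ≤ 8 * π * T ^ 3 := by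
      rw [← hη', ← hTη]
      have : 0 < π * T ^ 3 := by positivity
      nlinarith
    have h2 : |(j : ℝ)| ^ 2 * r ^ 2 ≤ 8 * π * T := by
      have : 0 < T ^ 2 := by positivity
      refine le_of_mul_le_mul_right ?_ this
      linarith
    refine le_trans ?_ h2
    gcongr
  have hP := h r hrpos hr2
  have hamp : resAmp c η j = r ^ 3 / (8000 * π) := by
    unfold resAmp
    have hc0 : c = η ^ 2 / (8000 * π * T ^ 3) := by
      rw [← hTη]
      field_simp
    rw [hc0, hη']
    field_simp
  rw [resInt, hamp, hrT, div_mul_eq_mul_div, div_le_iff₀ (by positivity)]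
  linarith

lemma hopBound_resInt {c η t T : ℝ} (hc : 0 < c) (hc' : c < 0.001) (hη : 0 < η) (ht : 0 ≤ t)
    (htT : t ≤ T) (hT : 0 < T) (hTη : 8000 * π * c * T ^ 3 = η ^ 2) :
    HopBound (fun j => 2.0002 * (1600 * resInt c η t j)) 0.949 := by
  have scale : ∀ {M : ℝ} {j : ℤ}, resInt c η T j ≤ M / 8000 →
      2.0002 * (1600 * resInt c η t j) ≤ 0.40004 * M := fun {M j} h => by
    have := resInt_mono hc hη htT j
    linarith
  have two : ∀ j : ℤ, |j| = 2 → 2.0002 * (1600 * resInt c η t j) ≤ 0.40004 * 1.35 :=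
    fun j hj => by
    have hj' : |(j : ℝ)| = 2 := by exact_mod_cast hj
    refine scale (resInt_le hη hT hTη hc' (by rintro rfl; simp at hj) (n := 2) (by norm_num)
      hj'.ge fun r hr h => cube_arctan_le_second hr hT (by linarith))
  have one : ∀ {M : ℝ}, (∀ r : ℝ, 0 < r → r ^ 2 ≤ 8 * π * T →
      r ^ 3 * (arctan (T - r * T) + arctan (r * T)) ≤ M * π) →
      ∀ j : ℤ, |j| = 1 → 2.0002 * (1600 * resInt c η t j) ≤ 0.40004 * M := fun h j hj => by
    have hj' : |(j : ℝ)| = 1 := by exact_mod_cast hj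
    exact scale (resInt_le hη hT hTη hc' (by rintro rfl; simp at hj) (n := 1) (by norm_num)
      hj'.ge fun r hr h1 => h r hr (by linarith))
  have three : ∀ {M : ℝ}, (∀ r : ℝ, 0 < r → 9 * r ^ 2 ≤ 8 * π * T →
      r ^ 3 * (arctan (T - r * T) + arctan (r * T)) ≤ M * π) →
      ∀ j : ℤ, 3 ≤ |j| → 2.0002 * (1600 * resInt c η t j) ≤ 0.40004 * M := fun h j hj => by
    have hj' : 3 ≤ |(j : ℝ)| := by exact_mod_cast hj
    exact scale (resInt_le hη hT hTη hc' (by rintro rfl; simp at hj) (n := 3) (by norm_num)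
      hj' fun r hr h1 => h r hr (by linarith))
  refine ⟨fun j => by have := resInt_nonneg hc hη ht j; positivity, ?_⟩
  rcases le_total T 0.93 with hT1 | hT1
  · exact ⟨2 / 19, _, _, _, by norm_num, by norm_num,
      one fun r hr h => cube_arctan_le_first hr hT h, two,
      three fun r hr h => cube_arctan_le_third_early hr hT hT1 h,
      by norm_num, by norm_num, by norm_num⟩
  · exact ⟨5 / 13, _, _, _, by norm_num, by norm_num,
      one fun r hr h => cube_arctan_le_first_late hr hT1 h, two,
      three fun r hr h => (cube_arctan_le_third hr hT h).trans_eq (one_mul π).symm,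
      by norm_num, by norm_num, by norm_num⟩

lemma hopBound_feedbackInt {c η t T : ℝ} (hc : 0 < c) (hc' : c < 0.001) (hη : 0 < η)
    (ht : 0 ≤ t) (htT : t ≤ T) (hT : 0 < T) (hTη : 8000 * π * c * T ^ 3 = η ^ 2) :
    HopBound (fun j => 2.0002 * feedbackInt c η t j) 0.0205 := by
  have hπ := pi_pos
  have key : ∀ {M m : ℝ} {j : ℤ}, resInt c η T j ≤ M / 8000 →
      (|(j : ℝ)| + 1) / |(j : ℝ)| ^ 2 ≤ m →
      2.0002 * feedbackInt c η t j ≤ 2.0002 * (0.0047124 * m + M / 8000) := fun {M m j} h hm => by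
    have h1 := resInt_mono hc hη htT j
    have h2 : 0 ≤ (|(j : ℝ)| + 1) / |(j : ℝ)| ^ 2 := by positivity
    have h3 : c * (3 * π / 2) ≤ 0.0047124 := by nlinarith [pi_lt_d4]
    have h4 : c * (|(j : ℝ)| + 1) / |(j : ℝ)| ^ 2 * (3 * π / 2) ≤ 0.0047124 * m := by
      calc _ = c * (3 * π / 2) * ((|(j : ℝ)| + 1) / |(j : ℝ)| ^ 2) := by ring
        _ ≤ _ := by gcongr
    unfold feedbackInt
    linarith
  refine ⟨fun j => by have := feedbackInt_nonneg hc hη ht j; positivity,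
    2 / 19, 2.0002 * (0.0047124 * 2 + 2.25 / 8000), 2.0002 * (0.0047124 * 0.75 + 1.35 / 8000),
    2.0002 * (0.0047124 * (4 / 9) + 1 / 8000), by norm_num, by norm_num, fun j hj => ?_,
    fun j hj => ?_, fun j hj => ?_, by norm_num, by norm_num, by norm_num⟩
  · have hj' : |(j : ℝ)| = 1 := by exact_mod_cast hj
    refine key (resInt_le hη hT hTη hc' (by rintro rfl; simp at hj) (n := 1) (by norm_num)
      hj'.ge fun r hr h => cube_arctan_le_first hr hT (by linarith)) ?_
    rw [hj']
    norm_num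
  · have hj' : |(j : ℝ)| = 2 := by exact_mod_cast hj
    refine key (resInt_le hη hT hTη hc' (by rintro rfl; simp at hj) (n := 2) (by norm_num)
      hj'.ge fun r hr h => cube_arctan_le_second hr hT (by linarith)) ?_
    rw [hj']
    norm_num
  · have hj' : 3 ≤ |(j : ℝ)| := by exact_mod_cast hj
    refine key (resInt_le hη hT hTη hc' (by rintro rfl; simp at hj) (n := 3) (by norm_num)
      hj' fun r hr h =>
        (cube_arctan_le_third hr hT (by linarith)).trans_eq (one_mul π).symm) ?_
    rw [div_le_iff₀ (by positivity)]
    nlinarith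

/-- The resonance profile of mode `j`. -/
noncomputable def resProfile (c η : ℝ) (j : ℤ) (s : ℝ) : ℝ :=
  resAmp c η j * (1 + (s - resTime η j) ^ 2)⁻¹

lemma resProfile_nonneg {c η : ℝ} (hc : 0 < c) (hη : 0 < η) (j : ℤ) (s : ℝ) :
    0 ≤ resProfile c η j s := by
  have := resAmp_nonneg hc hη j
  unfold resProfile
  positivity

lemma sub_resTime_sq_le {η s : ℝ} (hη : 0 < η) (hs : 0 ≤ s) (j : ℤ) :
    (s - resTime η j) ^ 2 ≤ (η / (j : ℝ) - s) ^ 2 := by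
  unfold resTime
  rcases le_total 0 (j : ℝ) with h | h
  · rw [abs_of_nonneg h]
    exact (by ring : _ = _).le
  · rw [abs_of_nonpos h, div_neg]
    have : η / (j : ℝ) ≤ 0 := div_nonpos_of_nonneg_of_nonpos hη.le h
    nlinarith

lemma abs_coupling_le {c η s : ℝ} (hc : 0 < c) (hη : 0 < η) (hs : 0 ≤ s) (j : ℤ) :
    |c * η / (j : ℝ) ^ 3 * (1 + (η / (j : ℝ) - s) ^ 2)⁻¹| ≤ resProfile c η j s := by
  unfold resProfile resAmp
  rw [abs_mul, abs_div, abs_pow, abs_of_pos (mul_pos hc hη), abs_inv,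
    abs_of_pos (by positivity : 0 < 1 + (η / (j : ℝ) - s) ^ 2)]
  have := sub_resTime_sq_le hη hs j
  gcongr

lemma abs_coupling_sq_le {c η s : ℝ} (hc : 0 < c) (hη : 0 < η) (hs : 0 ≤ s) (j : ℤ) :
    |c * η / (j : ℝ) ^ 3 * ((1 + (η / (j : ℝ) - s) ^ 2) ^ 2)⁻¹| ≤ resProfile c η j s := by
  refine le_trans ?_ (abs_coupling_le hc hη hs j)
  rw [abs_mul, abs_mul, abs_inv, abs_inv, abs_pow,
    abs_of_pos (by positivity : 0 < 1 + (η / (j : ℝ) - s) ^ 2)]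
  gcongr
  nlinarith [sq_nonneg (η / (j : ℝ) - s)]

lemma abs_cP_le {c η s : ℝ} (hc : 0 < c) (hη : 0 < η) (hs : 0 ≤ s) (l : ℤ) :
    |cP c η l s| ≤ resProfile c η (l + 1) s := by
  unfold cP
  split_ifs
  · simpa using resProfile_nonneg hc hη _ _
  · simpa using abs_coupling_sq_le hc hη hs (l + 1)

lemma abs_cM_le {c η s : ℝ} (hc : 0 < c) (hη : 0 < η) (hs : 0 ≤ s) (l : ℤ) :
    |cM c η l s| ≤ resProfile c η (l - 1) s := by
  unfold cM
  split_ifs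
  · simpa using resProfile_nonneg hc hη _ _
  · simpa using abs_coupling_sq_le hc hη hs (l - 1)

lemma abs_dP_le {c η s : ℝ} (hc : 0 < c) (hη : 0 < η) (hs : 0 ≤ s) (l : ℤ) :
    |dP c η l s| ≤ resProfile c η (l + 1) s := by
  unfold dP
  split_ifs
  · simpa using resProfile_nonneg hc hη _ _
  · simpa using abs_coupling_le hc hη hs (l + 1)

lemma abs_dM_le {c η s : ℝ} (hc : 0 < c) (hη : 0 < η) (hs : 0 ≤ s) (l : ℤ) :
    |dM c η l s| ≤ resProfile c η (l - 1) s := by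
  unfold dM
  split_ifs
  · simpa using resProfile_nonneg hc hη _ _
  · simpa using abs_coupling_le hc hη hs (l - 1)

lemma norm_thetaRHS_le {c η s : ℝ} (hc : 0 < c) (hη : 0 < η) (hs : 0 ≤ s)
    {θ G : ℝ → ℤ → ℂ} {Θ Γ : ℤ → ℝ} (hΘ : ∀ j, ‖θ s j‖ ≤ Θ j) (hΓ : ∀ j, ‖G s j‖ ≤ Γ j)
    (l : ℤ) : ‖thetaRHS c η θ G l s‖ ≤
      resProfile c η (l + 1) s * (Θ (l + 1) + Γ (l + 1))
        + resProfile c η (l - 1) s * (Θ (l - 1) + Γ (l - 1)) := by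
  have key : ∀ {a b B : ℝ} {z : ℂ}, |a| ≤ b → ‖z‖ ≤ B → ‖(a : ℂ) * z‖ ≤ b * B :=
    fun {a b B z} ha hz => by
    rw [norm_mul, Complex.norm_real, norm_eq_abs]
    exact mul_le_mul ha hz (norm_nonneg _) ((abs_nonneg _).trans ha)
  have h1 := key (abs_cP_le hc hη hs l) (hΘ (l + 1))
  have h2 := key (abs_cM_le hc hη hs l) (hΘ (l - 1))
  have h3 := key (abs_dP_le hc hη hs l) (hΓ (l + 1))
  have h4 := key (abs_dM_le hc hη hs l) (hΓ (l - 1))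
  unfold thetaRHS
  refine (norm_add₄_le).trans ?_
  linarith

lemma GRHS_eq (ν c η : ℝ) (f : ℝ → ℝ) (θ G : ℝ → ℤ → ℂ) (l : ℤ) (t : ℝ) :
    GRHS ν c η f θ G l t =
      -((ν * ((l : ℝ) ^ 2 + (η - (l : ℝ) * t) ^ 2) : ℝ) : ℂ) * G t l
      + ((f t : ℂ) * (Complex.I * (l : ℂ) / ((2 * c : ℝ) : ℂ)) * thetaRHS c η θ G l t
        + ((2 * (η / (l : ℝ) - t) * ((1 + (η / (l : ℝ) - t) ^ 2) ^ 2)⁻¹ : ℝ) : ℂ) * θ t l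
        + (((1 + (η / (l : ℝ) - t) ^ 2)⁻¹ : ℝ) : ℂ) * thetaRHS c η θ G l t) := by
  unfold GRHS thetaRHS
  ring

/-- The density whose time integral is controlled by `feedbackInt`. -/
noncomputable def feedbackProfile (c η : ℝ) (j : ℤ) (s : ℝ) : ℝ :=
  c * (|(j : ℝ)| + 1) / |(j : ℝ)| ^ 2 * ((1 + s ^ 2)⁻¹ + (1 + (s - resTime η j) ^ 2)⁻¹)
    + resProfile c η j s

lemma inv_mul_inv_le (s x : ℝ) :
    (1 + s ^ 2)⁻¹ * (1 + (s - x) ^ 2)⁻¹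
      ≤ 2 / (4 + x ^ 2) * ((1 + s ^ 2)⁻¹ + (1 + (s - x) ^ 2)⁻¹) := by
  have hA : 0 < 1 + s ^ 2 := by positivity
  have hB : 0 < 1 + (s - x) ^ 2 := by positivity
  have e : 2 / (4 + x ^ 2) * ((1 + s ^ 2)⁻¹ + (1 + (s - x) ^ 2)⁻¹)
      = (2 * ((1 + s ^ 2) + (1 + (s - x) ^ 2)) / (4 + x ^ 2))
        * ((1 + s ^ 2)⁻¹ * (1 + (s - x) ^ 2)⁻¹) := by
    field_simp
    ring
  rw [e]
  refine le_mul_of_one_le_left (by positivity) ?_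
  rw [le_div_iff₀ (by positivity)]
  nlinarith [sq_nonneg (2 * s - x)]

lemma feedback_mul_resProfile_le {c η s : ℝ} (hc : 0 < c) (hη : 0 < η) {m : ℝ} {j : ℤ}
    (hm : m ≤ |(j : ℝ)| + 1) :
    (2 * m * (1 + s ^ 2)⁻¹ + 1) * resProfile c η j s ≤ feedbackProfile c η j s := by
  have hkey : 2 * m * (1 + s ^ 2)⁻¹ * resProfile c η j s ≤
      c * (|(j : ℝ)| + 1) / |(j : ℝ)| ^ 2 *
        ((1 + s ^ 2)⁻¹ + (1 + (s - resTime η j) ^ 2)⁻¹) := by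
    rcases eq_or_ne j 0 with rfl | hj
    · simp [resProfile, resAmp]
    have hj' : 0 < |(j : ℝ)| := abs_pos.2 (Int.cast_ne_zero.2 hj)
    have hp := resProfile_nonneg hc hη j s
    have hamp := resAmp_nonneg hc hη j
    set S := (1 + s ^ 2)⁻¹ + (1 + (s - resTime η j) ^ 2)⁻¹ with hS
    have hS0 : 0 ≤ S := by positivity
    calc 2 * m * (1 + s ^ 2)⁻¹ * resProfile c η j s
        ≤ 2 * (|(j : ℝ)| + 1) * (1 + s ^ 2)⁻¹ * resProfile c η j s := by gcongr
      _ = 2 * (|(j : ℝ)| + 1) * resAmp c η j *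
          ((1 + s ^ 2)⁻¹ * (1 + (s - resTime η j) ^ 2)⁻¹) := by
        unfold resProfile
        ring
      _ ≤ 2 * (|(j : ℝ)| + 1) * resAmp c η j * (2 / (4 + resTime η j ^ 2) * S) := by
        exact mul_le_mul_of_nonneg_left (inv_mul_inv_le _ _) (by positivity)
      _ = c * (|(j : ℝ)| + 1) / |(j : ℝ)| ^ 2 *
          (4 * η * |(j : ℝ)| / (4 * |(j : ℝ)| ^ 2 + η ^ 2)) * S := by
        unfold resAmp resTime
        field_simp
        ring
      _ ≤ c * (|(j : ℝ)| + 1) / |(j : ℝ)| ^ 2 * 1 * S := by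
        gcongr
        rw [div_le_one (by positivity)]
        nlinarith [sq_nonneg (2 * |(j : ℝ)| - η)]
      _ = _ := by ring
  unfold feedbackProfile
  linarith

lemma hasDerivAt_arctan_sub (a s : ℝ) :
    HasDerivAt (fun s => arctan (s - a)) (1 + (s - a) ^ 2)⁻¹ s := by
  simpa using ((hasDerivAt_id s).sub_const a).arctan

lemma norm_le_of_damped {y r : ℝ → ℂ} {a φ Φ : ℝ → ℝ} {t : ℝ}
    (hy : ∀ s, HasDerivAt y (-(a s : ℂ) * y s + r s) s) (ha : ∀ s, 0 ≤ a s)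
    (hr : ∀ s ∈ Set.Icc 0 t, ‖r s‖ ≤ φ s) (hΦ : ∀ s, HasDerivAt Φ (φ s) s) :
    ∀ s ∈ Set.Icc 0 t, ‖y s‖ ≤ ‖y 0‖ + (Φ s - Φ 0) := by
  intro s hs
  refine le_of_forall_pos_le_add fun δ hδ => ?_
  have hpos : ∀ s, 0 < ‖y s‖ ^ 2 + δ ^ 2 := fun s => by positivity
  have hψ : ∀ s, HasDerivAt (fun s => √(‖y s‖ ^ 2 + δ ^ 2))
      (2 * inner ℝ (y s) (-(a s : ℂ) * y s + r s) / (2 * √(‖y s‖ ^ 2 + δ ^ 2))) s := fun s =>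
    ((hy s).norm_sq.add_const (δ ^ 2)).sqrt (hpos s).ne'
  have hB : ∀ s, HasDerivAt (fun s => √(‖y 0‖ ^ 2 + δ ^ 2) + (Φ s - Φ 0)) (φ s) s := fun s =>
    ((hΦ s).sub_const _).const_add _
  have h := image_le_of_deriv_right_le_deriv_boundary (a := 0) (b := t)
    (fun s _ => (hψ s).continuousAt.continuousWithinAt) (fun s _ => (hψ s).hasDerivWithinAt)
    (B := fun s => √(‖y 0‖ ^ 2 + δ ^ 2) + (Φ s - Φ 0)) (by simp)
    (fun s _ => (hB s).continuousAt.continuousWithinAt) (fun s _ => (hB s).hasDerivWithinAt)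
    (fun s hs' => by
      rw [div_le_iff₀ (by have := sqrt_pos.2 (hpos s); positivity), inner_add_right]
      have e : inner ℝ (y s) (-(a s : ℂ) * y s) = -a s * ‖y s‖ ^ 2 := by
        rw [← Complex.ofReal_neg, ← Complex.real_smul, inner_smul_right, real_inner_self_eq_norm_sq]
      have h1 : inner ℝ (y s) (r s) ≤ ‖y s‖ * ‖r s‖ := real_inner_le_norm _ _
      have h2 : ‖y s‖ ≤ √(‖y s‖ ^ 2 + δ ^ 2) := le_sqrt_of_sq_le (by nlinarith)
      have h3 : ‖r s‖ ≤ φ s := hr s ⟨hs'.1, hs'.2.le⟩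
      have h4 : ‖y s‖ * ‖r s‖ ≤ √(‖y s‖ ^ 2 + δ ^ 2) * φ s :=
        mul_le_mul h2 h3 (norm_nonneg _) (sqrt_nonneg _)
      have h5 := mul_nonneg (ha s) (sq_nonneg ‖y s‖)
      rw [e]
      linarith) hs
  have h1 : ‖y s‖ ≤ √(‖y s‖ ^ 2 + δ ^ 2) := le_sqrt_of_sq_le (by nlinarith)
  have h2 : √(‖y 0‖ ^ 2 + δ ^ 2) ≤ ‖y 0‖ + δ :=
    sqrt_le_iff.2 ⟨by positivity, by nlinarith [norm_nonneg (y 0)]⟩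
  linarith

lemma IsWaveSol.norm_theta_le {ν c η t : ℝ} {f : ℝ → ℝ} {θ G : ℝ → ℤ → ℂ}
    (hsol : IsWaveSol ν c η f θ G) (hc : 0 < c) (hη : 0 < η) {Θ Γ : ℤ → ℝ}
    (hΘ : ∀ s ∈ Set.Icc 0 t, ∀ j, ‖θ s j‖ ≤ Θ j) (hΓ : ∀ s ∈ Set.Icc 0 t, ∀ j, ‖G s j‖ ≤ Γ j)
    (hΘ0 : ∀ j, 0 ≤ Θ j) (hΓ0 : ∀ j, 0 ≤ Γ j) {l : ℤ} (hl : l ≠ 0) :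
    ∀ s ∈ Set.Icc 0 t, ‖θ s l‖ ≤ ‖θ 0 l‖ + (resInt c η t (l + 1) * (Θ (l + 1) + Γ (l + 1))
      + resInt c η t (l - 1) * (Θ (l - 1) + Γ (l - 1))) := by
  intro s hs
  have hder : ∀ j s, HasDerivAt (fun s => resAmp c η j * arctan (s - resTime η j))
      (resProfile c η j s) s := fun j s => (hasDerivAt_arctan_sub _ s).const_mul _
  have h := norm_le_of_damped (a := fun _ => 0)
    (fun s => by simpa using (hsol.2.2 l hl s).1) (fun _ => le_rfl)
    (fun s hs => norm_thetaRHS_le hc hη hs.1 (hΘ s hs) (hΓ s hs) l)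
    (fun s => ((hder (l + 1) s).mul_const (Θ (l + 1) + Γ (l + 1))).add
      ((hder (l - 1) s).mul_const (Θ (l - 1) + Γ (l - 1)))) s hs
  have hinc : ∀ j, resAmp c η j * arctan (s - resTime η j) * (Θ j + Γ j)
      - resAmp c η j * arctan (0 - resTime η j) * (Θ j + Γ j)
      ≤ resInt c η t j * (Θ j + Γ j) := fun j => by
    have h1 := resInt_mono hc hη hs.2 j
    have e : resAmp c η j * arctan (s - resTime η j) * (Θ j + Γ j)
      - resAmp c η j * arctan (0 - resTime η j) * (Θ j + Γ j) = resInt c η s j * (Θ j + Γ j) := by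
      rw [resInt, zero_sub, arctan_neg]
      ring
    rw [e]
    exact mul_le_mul_of_nonneg_right h1 (add_nonneg (hΘ0 j) (hΓ0 j))
  have := hinc (l + 1)
  have := hinc (l - 1)
  simp only [Pi.add_apply] at h
  linarith

lemma two_mul_abs_mul_inv_le (x : ℝ) : |2 * x * ((1 + x ^ 2) ^ 2)⁻¹| ≤ (1 + x ^ 2)⁻¹ := by
  have h : 0 < 1 + x ^ 2 := by positivity
  rw [abs_mul, abs_mul, abs_inv, abs_pow, abs_of_pos h, abs_two, ← div_eq_mul_inv,
    div_le_iff₀ (by positivity), pow_two (1 + x ^ 2), inv_mul_cancel_left₀ h.ne']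
  nlinarith [sq_nonneg (|x| - 1), sq_abs x]

lemma IsWaveSol.norm_G_le {ν c η t : ℝ} {f : ℝ → ℝ} {θ G : ℝ → ℤ → ℂ}
    (hsol : IsWaveSol ν c η f θ G) (hν : 0 < ν) (hc : 0 < c) (hη : 0 < η)
    (hfb : ∀ t : ℝ, 0 ≤ t → |f t| ≤ 4 * c / (1 + t ^ 2)) {Θ Γ : ℤ → ℝ}
    (hΘ : ∀ s ∈ Set.Icc 0 t, ∀ j, ‖θ s j‖ ≤ Θ j) (hΓ : ∀ s ∈ Set.Icc 0 t, ∀ j, ‖G s j‖ ≤ Γ j)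
    (hΘ0 : ∀ j, 0 ≤ Θ j) (hΓ0 : ∀ j, 0 ≤ Γ j) {l : ℤ} (hl : l ≠ 0) :
    ∀ s ∈ Set.Icc 0 t, ‖G s l‖ ≤ ‖G 0 l‖ + (feedbackInt c η t (l + 1) * (Θ (l + 1) + Γ (l + 1))
      + feedbackInt c η t (l - 1) * (Θ (l - 1) + Γ (l - 1)) + π * Θ l) := by
  intro s hs
  have hder : ∀ (j : ℤ) (s : ℝ), HasDerivAt (fun s => c * (|(j : ℝ)| + 1) / |(j : ℝ)| ^ 2 *
        (arctan s + arctan (s - resTime η j)) + resAmp c η j * arctan (s - resTime η j))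
      (feedbackProfile c η j s) s := fun j s =>
    (((hasDerivAt_arctan' s).add (hasDerivAt_arctan_sub _ s)).const_mul _).add
      ((hasDerivAt_arctan_sub _ s).const_mul _)
  have hrest : ∀ s ∈ Set.Icc 0 t,
      ‖(f s : ℂ) * (Complex.I * (l : ℂ) / ((2 * c : ℝ) : ℂ)) * thetaRHS c η θ G l s
        + ((2 * (η / (l : ℝ) - s) * ((1 + (η / (l : ℝ) - s) ^ 2) ^ 2)⁻¹ : ℝ) : ℂ) * θ s l
        + (((1 + (η / (l : ℝ) - s) ^ 2)⁻¹ : ℝ) : ℂ) * thetaRHS c η θ G l s‖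
      ≤ feedbackProfile c η (l + 1) s * (Θ (l + 1) + Γ (l + 1))
        + feedbackProfile c η (l - 1) s * (Θ (l - 1) + Γ (l - 1))
        + (1 + (s - resTime η l) ^ 2)⁻¹ * Θ l := fun s hs => by
    have hB := norm_thetaRHS_le hc hη hs.1 (hΘ s hs) (hΓ s hs) l
    have n1 : ‖(f s : ℂ) * (Complex.I * (l : ℂ) / ((2 * c : ℝ) : ℂ))‖
        ≤ 2 * |(l : ℝ)| * (1 + s ^ 2)⁻¹ := by
      rw [norm_mul, norm_div, norm_mul, Complex.norm_I, Complex.norm_real, Complex.norm_real,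
        Complex.norm_intCast, norm_eq_abs, norm_eq_abs, abs_of_pos (by positivity : 0 < 2 * c),
        one_mul]
      calc |f s| * (|(l : ℝ)| / (2 * c)) ≤ 4 * c / (1 + s ^ 2) * (|(l : ℝ)| / (2 * c)) := by
            gcongr
            exact hfb s hs.1
        _ = _ := by
            field_simp
            norm_num
    have n2 : ‖(((1 + (η / (l : ℝ) - s) ^ 2)⁻¹ : ℝ) : ℂ)‖ ≤ 1 := by
      rw [Complex.norm_real, norm_eq_abs, abs_of_pos (by positivity)]
      exact inv_le_one_of_one_le₀ (by nlinarith [sq_nonneg (η / (l : ℝ) - s)])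
    have n3 : ‖((2 * (η / (l : ℝ) - s) * ((1 + (η / (l : ℝ) - s) ^ 2) ^ 2)⁻¹ : ℝ) : ℂ) * θ s l‖
        ≤ (1 + (s - resTime η l) ^ 2)⁻¹ * Θ l := by
      rw [norm_mul, Complex.norm_real, norm_eq_abs]
      refine mul_le_mul ((two_mul_abs_mul_inv_le _).trans ?_) (hΘ s hs l) (norm_nonneg _)
        (by positivity)
      have := sub_resTime_sq_le hη hs.1 l
      gcongr
    have hl1 : |(l : ℝ)| ≤ |((l + 1 : ℤ) : ℝ)| + 1 := by
      have : |l| ≤ |l + 1| + 1 := by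
        rw [abs_le]
        constructor <;> rcases abs_cases (l + 1) with h | h <;> omega
      exact_mod_cast this
    have hl2 : |(l : ℝ)| ≤ |((l - 1 : ℤ) : ℝ)| + 1 := by
      have : |l| ≤ |l - 1| + 1 := by
        rw [abs_le]
        constructor <;> rcases abs_cases (l - 1) with h | h <;> omega
      exact_mod_cast this
    have m1 := mul_le_mul_of_nonneg_right (feedback_mul_resProfile_le (s := s) hc hη hl1)
      (add_nonneg (hΘ0 (l + 1)) (hΓ0 (l + 1)))
    have m2 := mul_le_mul_of_nonneg_right (feedback_mul_resProfile_le (s := s) hc hη hl2)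
      (add_nonneg (hΘ0 (l - 1)) (hΓ0 (l - 1)))
    refine norm_add₃_le.trans ?_
    rw [norm_mul, norm_mul _ (thetaRHS c η θ G l s)]
    have k1 := mul_le_mul n1 hB (norm_nonneg _) (by positivity)
    have k2 := mul_le_mul n2 hB (norm_nonneg _) zero_le_one
    linarith
  have h := norm_le_of_damped
    (a := fun s => ν * ((l : ℝ) ^ 2 + (η - (l : ℝ) * s) ^ 2))
    (fun s => (GRHS_eq ν c η f θ G l s) ▸ (hsol.2.2 l hl s).2) (fun _ => by positivity) hrest
    (fun s => (((hder (l + 1) s).mul_const (Θ (l + 1) + Γ (l + 1))).add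
      ((hder (l - 1) s).mul_const (Θ (l - 1) + Γ (l - 1)))).add
      ((hasDerivAt_arctan_sub (resTime η l) s).mul_const (Θ l))) s hs
  have hinc : ∀ j : ℤ, (c * (|(j : ℝ)| + 1) / |(j : ℝ)| ^ 2 *
        (arctan s + arctan (s - resTime η j)) + resAmp c η j * arctan (s - resTime η j))
          * (Θ j + Γ j)
      - (c * (|(j : ℝ)| + 1) / |(j : ℝ)| ^ 2 *
        (arctan 0 + arctan (0 - resTime η j)) + resAmp c η j * arctan (0 - resTime η j))
          * (Θ j + Γ j)
      ≤ feedbackInt c η t j * (Θ j + Γ j) := fun j => by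
    have h1 := resInt_mono hc hη hs.2 j
    have h2 := arctan_sum_le_pi (resTime η j) s
    have h3 := arctan_lt_pi_div_two s
    have h4 : 0 ≤ c * (|(j : ℝ)| + 1) / |(j : ℝ)| ^ 2 := by positivity
    have h5 : c * (|(j : ℝ)| + 1) / |(j : ℝ)| ^ 2 *
        (arctan s + arctan (s - resTime η j) + arctan (resTime η j))
        ≤ c * (|(j : ℝ)| + 1) / |(j : ℝ)| ^ 2 * (3 * π / 2) := by
      gcongr
      linarith
    rw [← sub_mul]
    refine mul_le_mul_of_nonneg_right ?_ (add_nonneg (hΘ0 j) (hΓ0 j))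
    have e : resInt c η s j = resAmp c η j * arctan (s - resTime η j)
        - resAmp c η j * arctan (0 - resTime η j) := by
      rw [resInt, zero_sub, arctan_neg]
      ring
    rw [arctan_zero, feedbackInt]
    rw [zero_sub, arctan_neg] at e ⊢
    linarith
  have i1 := hinc (l + 1)
  have i2 := hinc (l - 1)
  have i3 : arctan (s - resTime η l) * Θ l - arctan (0 - resTime η l) * Θ l ≤ π * Θ l := by
    rw [← sub_mul, zero_sub, arctan_neg, sub_neg_eq_add]
    exact mul_le_mul_of_nonneg_right (arctan_sum_le_pi _ _) (hΘ0 l)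
  simp only [Pi.add_apply] at h
  linarith

lemma Xnorm_eq_l2norm (lam : ℤ → ℝ) (u : ℤ → ℂ) : Xnorm lam u = l2norm fun l => lam l * ‖u l‖ := by
  simp only [Xnorm, l2norm, mul_pow]

/-- The weight `lam` with an additional geometric decay of ratio `ρ`. -/
def dampedWeight (ρ : ℝ) (lam : ℤ → ℝ) (l : ℤ) : ℝ := ρ ^ l.natAbs * lam l

lemma dampedWeight_nonneg {ρ : ℝ} {lam : ℤ → ℝ} (hρ : 0 ≤ ρ) (hlam : GoodWeight lam) (l : ℤ) :
    0 ≤ dampedWeight ρ lam l :=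
  mul_nonneg (pow_nonneg hρ _) (hlam.1 l).le

lemma dampedWeight_le {ρ : ℝ} {lam : ℤ → ℝ} (hρ : 0 ≤ ρ) (hρ1 : ρ ≤ 1) (hlam : GoodWeight lam)
    (l : ℤ) : dampedWeight ρ lam l ≤ lam l :=
  mul_le_of_le_one_left (hlam.1 l).le (pow_le_one₀ hρ hρ1)

lemma dampedWeight_le_of_natAbs_le {ρ : ℝ} {lam : ℤ → ℝ} (hρ : 0 < ρ) (hρ1 : ρ ≤ 1)
    (hρ2 : 2 ≤ 2.0002 * ρ) {l j : ℤ} (hj : 0 < lam j) (hlj : lam l ≤ 2 * lam j)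
    (hjl : j.natAbs ≤ l.natAbs + 1) :
    dampedWeight ρ lam l ≤ 2.0002 * dampedWeight ρ lam j := by
  have h1 : ρ ^ (l.natAbs + 1) ≤ ρ ^ j.natAbs := pow_le_pow_of_le_one hρ.le hρ1 hjl
  have h2 : 0 < ρ ^ l.natAbs := pow_pos hρ _
  unfold dampedWeight
  calc ρ ^ l.natAbs * lam l ≤ ρ ^ l.natAbs * (2 * lam j) := by gcongr
    _ ≤ ρ ^ l.natAbs * ((2.0002 * ρ) * lam j) := by gcongr
    _ = 2.0002 * (ρ ^ (l.natAbs + 1) * lam j) := by ring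
    _ ≤ 2.0002 * (ρ ^ j.natAbs * lam j) := by gcongr

lemma dampedWeight_le_succ {ρ : ℝ} {lam : ℤ → ℝ} (hρ : 0 < ρ) (hρ1 : ρ ≤ 1)
    (hρ2 : 2 ≤ 2.0002 * ρ) (hlam : GoodWeight lam) (l : ℤ) :
    dampedWeight ρ lam l ≤ 2.0002 * dampedWeight ρ lam (l + 1) :=
  dampedWeight_le_of_natAbs_le hρ hρ1 hρ2 (hlam.1 _)
    (by simpa using (hlam.2.2 (l + 1)).le) (by omega)

lemma dampedWeight_le_pred {ρ : ℝ} {lam : ℤ → ℝ} (hρ : 0 < ρ) (hρ1 : ρ ≤ 1)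
    (hρ2 : 2 ≤ 2.0002 * ρ) (hlam : GoodWeight lam) (l : ℤ) :
    dampedWeight ρ lam l ≤ 2.0002 * dampedWeight ρ lam (l - 1) :=
  dampedWeight_le_of_natAbs_le hρ hρ1 hρ2 (hlam.1 _)
    (by simpa using (hlam.2.1 (l - 1)).le) (by omega)

lemma summable_dampedWeight_mul_sq {ρ B : ℝ} {lam u : ℤ → ℝ} (hρ : 0 ≤ ρ) (hρ1 : ρ < 1)
    (hB : ∀ l, lam l ^ 2 * u l ^ 2 ≤ B) :
    Summable fun l => (dampedWeight ρ lam l * u l) ^ 2 := by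
  have hgeom : Summable fun n : ℕ => (ρ ^ 2) ^ n * B :=
    (summable_geometric_of_lt_one (by positivity) (by nlinarith)).mul_right B
  have hs : Summable fun l : ℤ => (ρ ^ 2) ^ l.natAbs * B :=
    Summable.of_nat_of_neg (by simpa using hgeom) (by simpa using hgeom)
  refine hs.of_nonneg_of_le (fun _ => sq_nonneg _) fun l => ?_
  have e : (dampedWeight ρ lam l * u l) ^ 2 = (ρ ^ 2) ^ l.natAbs * (lam l ^ 2 * u l ^ 2) := by
    rw [← pow_mul, mul_comm 2, pow_mul, dampedWeight]
    ring
  rw [e]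
  exact mul_le_mul_of_nonneg_left (hB l) (by positivity)

lemma tendsto_l2norm_dampedWeight {lam : ℤ → ℝ} {u : ℤ → ℂ}
    (hu : Summable fun l => lam l ^ 2 * ‖u l‖ ^ 2) :
    Filter.Tendsto (fun ρ => l2norm fun l => dampedWeight ρ lam l * ‖u l‖)
      (nhdsWithin 1 (Set.Iio 1)) (nhds (Xnorm lam u)) := by
  rw [Xnorm_eq_l2norm]
  refine Filter.Tendsto.sqrt (tendsto_tsum_of_dominated_convergence hu (fun l => ?_) ?_)
  · have hcont : Continuous fun ρ : ℝ => (dampedWeight ρ lam l * ‖u l‖) ^ 2 := by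
      unfold dampedWeight
      fun_prop
    simpa [dampedWeight] using (hcont.tendsto 1).mono_left nhdsWithin_le_nhds
  · filter_upwards [Ioo_mem_nhdsLT zero_lt_one] with ρ hρ l
    rw [norm_of_nonneg (sq_nonneg _), ← mul_pow, dampedWeight, mul_assoc, mul_pow]
    exact mul_le_of_le_one_left (sq_nonneg _)
      (pow_le_one₀ (pow_nonneg hρ.1.le _) (pow_le_one₀ hρ.1.le hρ.2.le))

lemma exists_isMax_norm {u : ℝ → ℤ → ℂ} {t : ℝ} (ht : 0 ≤ t)
    (hu : ∀ j, Continuous fun s => u s j) :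
    ∃ U : ℤ → ℝ, (∀ s ∈ Set.Icc 0 t, ∀ j, ‖u s j‖ ≤ U j) ∧
      ∀ j, ∃ s ∈ Set.Icc 0 t, U j = ‖u s j‖ := by
  have h : ∀ j, ∃ m ∈ Set.Icc 0 t, ∀ s ∈ Set.Icc 0 t, ‖u s j‖ ≤ ‖u m j‖ := fun j =>
    isCompact_Icc.exists_isMaxOn ⟨0, le_rfl, ht⟩ (hu j).norm.continuousOn
  choose m hm hmax using h
  exact ⟨fun j => ‖u (m j) j‖, fun s hs j => hmax j s hs, fun j => ⟨m j, hm j, rfl⟩⟩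

lemma exists_bound_weighted_modes {lam : ℤ → ℝ} {u : ℝ → ℤ → ℂ} (t : ℝ)
    (hsum : ∀ s, Summable fun l => lam l ^ 2 * ‖u s l‖ ^ 2)
    (hcont : Continuous fun s => ∑' l, lam l ^ 2 * ‖u s l‖ ^ 2) :
    ∃ B, ∀ s ∈ Set.Icc 0 t, ∀ l, lam l ^ 2 * ‖u s l‖ ^ 2 ≤ B := by
  obtain ⟨B, hB⟩ := (isCompact_Icc (a := 0) (b := t)).bddAbove_image hcont.continuousOn
  exact ⟨B, fun s hs l => ((hsum s).le_tsum l fun _ _ => by positivity).trans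
    (hB (Set.mem_image_of_mem _ hs))⟩

lemma IsWaveSol.continuous_theta {ν c η : ℝ} {f : ℝ → ℝ} {θ G : ℝ → ℤ → ℂ}
    (hsol : IsWaveSol ν c η f θ G) (l : ℤ) : Continuous fun s => θ s l := by
  rcases eq_or_ne l 0 with rfl | hl
  · simpa only [hsol.1] using continuous_const
  · exact continuous_iff_continuousAt.2 fun t => (hsol.2.2 l hl t).1.continuousAt

lemma IsWaveSol.continuous_G {ν c η : ℝ} {f : ℝ → ℝ} {θ G : ℝ → ℤ → ℂ}
    (hsol : IsWaveSol ν c η f θ G) (l : ℤ) : Continuous fun s => G s l := by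
  rcases eq_or_ne l 0 with rfl | hl
  · simpa only [hsol.2.1] using continuous_const
  · exact continuous_iff_continuousAt.2 fun t => (hsol.2.2 l hl t).2.continuousAt

lemma IsWaveSol.l2norm_dampedWeight_le {ν c η t T ρ : ℝ} {f : ℝ → ℝ} {θ G : ℝ → ℤ → ℂ}
    {lam : ℤ → ℝ} (hsol : IsWaveSol ν c η f θ G) (hν : 0 < ν) (hc : 0 < c) (hc' : c < 0.001)
    (hη : 0 < η) (hfb : ∀ t : ℝ, 0 ≤ t → |f t| ≤ 4 * c / (1 + t ^ 2)) (hlam : GoodWeight lam)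
    (hθsum : ∀ s, Summable fun l => lam l ^ 2 * ‖θ s l‖ ^ 2)
    (hGsum : ∀ s, Summable fun l => lam l ^ 2 * ‖G s l‖ ^ 2)
    (hθcont : Continuous fun s => ∑' l, lam l ^ 2 * ‖θ s l‖ ^ 2)
    (hGcont : Continuous fun s => ∑' l, lam l ^ 2 * ‖G s l‖ ^ 2)
    (ht : 0 ≤ t) (htT : t ≤ T) (hT : 0 < T) (hTη : 8000 * π * c * T ^ 3 = η ^ 2)
    (hρ : 0 < ρ) (hρ1 : ρ < 1) (hρ2 : 2 ≤ 2.0002 * ρ) :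
    1600 * l2norm (fun l => dampedWeight ρ lam l * ‖θ t l‖)
        + l2norm (fun l => dampedWeight ρ lam l * ‖G t l‖)
      ≤ 2 * (1600 * Xnorm lam (θ 0) + Xnorm lam (G 0)) := by
  obtain ⟨Θ, hΘ, hΘmax⟩ := exists_isMax_norm ht hsol.continuous_theta
  obtain ⟨Γ, hΓ, hΓmax⟩ := exists_isMax_norm ht hsol.continuous_G
  obtain ⟨B, hB⟩ := exists_bound_weighted_modes t hθsum hθcont
  obtain ⟨B', hB'⟩ := exists_bound_weighted_modes t hGsum hGcont
  have hΘ0 : ∀ l, 0 ≤ Θ l := fun l => (norm_nonneg _).trans (hΘ 0 ⟨le_rfl, ht⟩ l)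
  have hΓ0 : ∀ l, 0 ≤ Γ l := fun l => (norm_nonneg _).trans (hΓ 0 ⟨le_rfl, ht⟩ l)
  have hΘz : Θ 0 = 0 := by
    obtain ⟨s, -, h⟩ := hΘmax 0
    rw [h, hsol.1, norm_zero]
  have hΓz : Γ 0 = 0 := by
    obtain ⟨s, -, h⟩ := hΓmax 0
    rw [h, hsol.2.1, norm_zero]
  have hΘle : ∀ l, l ≠ 0 → Θ l ≤ ‖θ 0 l‖ + (resInt c η t (l + 1) * (Θ (l + 1) + Γ (l + 1))
      + resInt c η t (l - 1) * (Θ (l - 1) + Γ (l - 1))) := fun l hl => by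
    obtain ⟨s, hs, h⟩ := hΘmax l
    rw [h]
    exact hsol.norm_theta_le hc hη hΘ hΓ hΘ0 hΓ0 hl s hs
  have hΓle : ∀ l, l ≠ 0 → Γ l ≤ ‖G 0 l‖ + (feedbackInt c η t (l + 1) * (Θ (l + 1) + Γ (l + 1))
      + feedbackInt c η t (l - 1) * (Θ (l - 1) + Γ (l - 1)) + π * Θ l) := fun l hl => by
    obtain ⟨s, hs, h⟩ := hΓmax l
    rw [h]
    exact hsol.norm_G_le hν hc hη hfb hΘ hΓ hΘ0 hΓ0 hl s hs
  set μ := dampedWeight ρ lam with hμ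
  have hμ0 : ∀ l, 0 ≤ μ l := dampedWeight_nonneg hρ.le hlam
  have hμle : ∀ l, μ l ≤ lam l := dampedWeight_le hρ.le hρ1.le hlam
  have hΘs : Summable fun l => (μ l * Θ l) ^ 2 :=
    summable_dampedWeight_mul_sq hρ.le hρ1 fun l => by
      obtain ⟨s, hs, h⟩ := hΘmax l
      rw [h]
      exact hB s hs l
  have hΓs : Summable fun l => (μ l * Γ l) ^ 2 :=
    summable_dampedWeight_mul_sq hρ.le hρ1 fun l => by
      obtain ⟨s, hs, h⟩ := hΓmax l
      rw [h]
      exact hB' s hs l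
  have mono : ∀ {u v : ℤ → ℝ} {κ : ℤ → ℝ}, (∀ l, 0 ≤ u l) → (∀ l, u l ≤ v l) →
      (∀ l, μ l ≤ κ l) → (Summable fun l => (κ l * v l) ^ 2) →
      (Summable fun l => (μ l * u l) ^ 2) ∧
        l2norm (fun l => μ l * u l) ≤ l2norm (fun l => κ l * v l) :=
    fun {u v κ} hu huv hκ hs => by
      have h0 : ∀ l, 0 ≤ μ l * u l := fun l => mul_nonneg (hμ0 l) (hu l)
      have hle : ∀ l, μ l * u l ≤ κ l * v l := fun l =>
        mul_le_mul (hκ l) (huv l) (hu l) ((hμ0 l).trans (hκ l))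
      exact ⟨summable_sq_of_le h0 hle hs, l2norm_mono h0 hle hs⟩
  have smul : ∀ {u : ℤ → ℝ}, (Summable fun l => u l ^ 2) →
      Summable fun l => (1600 * u l) ^ 2 := fun {u} hu => by
    simpa only [mul_pow] using hu.mul_left (1600 ^ 2)
  obtain ⟨hθ0s, hθ0le⟩ := mono (u := fun l => ‖θ 0 l‖) (fun l => norm_nonneg _) (fun _ => le_rfl)
    hμle (by simpa only [mul_pow] using hθsum 0)
  obtain ⟨hG0s, hG0le⟩ := mono (u := fun l => ‖G 0 l‖) (fun l => norm_nonneg _) (fun _ => le_rfl)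
    hμle (by simpa only [mul_pow] using hGsum 0)
  have hΘnorm := (mono (u := fun l => ‖θ t l‖) (fun l => norm_nonneg _)
    (hΘ t ⟨ht, le_rfl⟩) (fun _ => le_rfl) hΘs).2
  have hΓnorm := (mono (u := fun l => ‖G t l‖) (fun l => norm_nonneg _)
    (hΓ t ⟨ht, le_rfl⟩) (fun _ => le_rfl) hΓs).2
  have transfer : ∀ {a : ℤ → ℝ} (l : ℤ), (∀ j, 0 ≤ a j) →
      μ l * (a (l + 1) * (Θ (l + 1) + Γ (l + 1)) + a (l - 1) * (Θ (l - 1) + Γ (l - 1)))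
        ≤ 2.0002 * a (l + 1) * (μ (l + 1) * Γ (l + 1))
          + 2.0002 * a (l - 1) * (μ (l - 1) * Γ (l - 1))
          + 1 / 1600 * (2.0002 * a (l + 1) * (1600 * (μ (l + 1) * Θ (l + 1)))
          + 2.0002 * a (l - 1) * (1600 * (μ (l - 1) * Θ (l - 1)))) := fun {a} l ha => by
    have h1 := mul_le_mul_of_nonneg_right (dampedWeight_le_succ hρ hρ1.le hρ2 hlam l)
      (mul_nonneg (ha (l + 1)) (add_nonneg (hΘ0 (l + 1)) (hΓ0 (l + 1))))
    have h2 := mul_le_mul_of_nonneg_right (dampedWeight_le_pred hρ hρ1.le hρ2 hlam l)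
      (mul_nonneg (ha (l - 1)) (add_nonneg (hΘ0 (l - 1)) (hΓ0 (l - 1))))
    rw [← hμ] at h1 h2
    linarith
  have hsys := l2norm_system_le (hopBound_resInt hc hc' hη ht htT hT hTη)
    (hopBound_feedbackInt hc hc' hη ht htT hT hTη)
    (h := fun l => 1600 * (μ l * Θ l)) (g := fun l => μ l * Γ l)
    (h0 := fun l => 1600 * (μ l * ‖θ 0 l‖)) (g0 := fun l => μ l * ‖G 0 l‖)
    (fun l => mul_nonneg (by norm_num) (mul_nonneg (hμ0 l) (hΘ0 l)))
    (fun l => mul_nonneg (hμ0 l) (hΓ0 l))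
    (fun l => mul_nonneg (by norm_num) (mul_nonneg (hμ0 l) (norm_nonneg _)))
    (fun l => mul_nonneg (hμ0 l) (norm_nonneg _))
    (by simp [hΘz]) (by simp [hΓz]) (smul hΘs) hΓs (smul hθ0s) hG0s
    (fun l hl => by
      have h1 := mul_le_mul_of_nonneg_left (hΘle l hl) (hμ0 l)
      have h2 := transfer l fun j => resInt_nonneg hc hη ht j
      simp only [hop, hl, if_false]
      linarith)
    (fun l hl => by
      have h1 := mul_le_mul_of_nonneg_left (hΓle l hl) (hμ0 l)
      have h2 := transfer l fun j => feedbackInt_nonneg hc hη ht j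
      simp only [hop, hl, if_false]
      linarith)
  rw [l2norm_const_mul (by norm_num), l2norm_const_mul (by norm_num)] at hsys
  rw [Xnorm_eq_l2norm, Xnorm_eq_l2norm]
  linarith

lemma cube_early_time {c η : ℝ} (hc : 0 < c) (hη : 0 < η) :
    8000 * π * c * (η / (8000 * c * η * π) ^ ((1 : ℝ) / 3)) ^ 3 = η ^ 2 := by
  have h : 0 < 8000 * c * η * π := by positivity
  rw [div_pow, ← rpow_natCast (_ ^ _), ← rpow_mul h.le]
  norm_num
  field_simp

/-- **Stability in the early time regime `0 < t < η/(8000cηπ)^{1/3}`.** If `0 < c < 0.001`,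
then every solution of the wave perturbation system with finite `X`-norms satisfies
`40²‖θ(t)‖_X + ‖G(t)‖_X ≤ 2(40²‖θ(0)‖_X + ‖G(0)‖_X)` on this interval. -/
theorem early_time_stability
    (ν c η : ℝ) (hν : 0 < ν) (hc : 0 < c) (hc' : c < 0.001) (hη : 0 < η)
    (f : ℝ → ℝ) (hf : Continuous f)
    (hfb : ∀ t : ℝ, 0 ≤ t → |f t| ≤ 4 * c / (1 + t ^ 2))
    (θ G : ℝ → ℤ → ℂ) (hsol : IsWaveSol ν c η f θ G)
    (lam : ℤ → ℝ) (hlam : GoodWeight lam)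
    (hθsum : ∀ t : ℝ, Summable fun l : ℤ => (lam l) ^ 2 * ‖θ t l‖ ^ 2)
    (hGsum : ∀ t : ℝ, Summable fun l : ℤ => (lam l) ^ 2 * ‖G t l‖ ^ 2)
    (hθderiv : ∀ t : ℝ, HasDerivAt (fun s => ∑' l : ℤ, (lam l) ^ 2 * ‖θ s l‖ ^ 2)
        (∑' l : ℤ, (lam l) ^ 2 * deriv (fun s => ‖θ s l‖ ^ 2) t) t)
    (hGderiv : ∀ t : ℝ, HasDerivAt (fun s => ∑' l : ℤ, (lam l) ^ 2 * ‖G s l‖ ^ 2)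
        (∑' l : ℤ, (lam l) ^ 2 * deriv (fun s => ‖G s l‖ ^ 2) t) t)
    (hIPderiv : ∀ t : ℝ, HasDerivAt
        (fun s => ∑' l : ℤ, (lam l) ^ 2 * ((starRingEnd ℂ) (θ s l) * G s l).re)
        (∑' l : ℤ, (lam l) ^ 2 * deriv (fun s => ((starRingEnd ℂ) (θ s l) * G s l).re) t)
        t) :
    ∀ t : ℝ, 0 < t → t < η / (8000 * c * η * Real.pi) ^ ((1 : ℝ) / 3) →
      (40 : ℝ) ^ 2 * Xnorm lam (θ t) + Xnorm lam (G t)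
        ≤ 2 * ((40 : ℝ) ^ 2 * Xnorm lam (θ 0) + Xnorm lam (G 0)) := by
  intro t ht htT
  have hT : 0 < η / (8000 * c * η * Real.pi) ^ ((1 : ℝ) / 3) := ht.trans htT
  have hθcont := continuous_iff_continuousAt.2 fun s => (hθderiv s).continuousAt
  have hGcont := continuous_iff_continuousAt.2 fun s => (hGderiv s).continuousAt
  have hlim := ((tendsto_l2norm_dampedWeight (hθsum t)).const_mul 1600).add
    (tendsto_l2norm_dampedWeight (hGsum t))
  have hbound := le_of_tendsto hlim (by
    filter_upwards [Ioo_mem_nhdsLT (show (0.99995 : ℝ) < 1 by norm_num)] with ρ hρ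
    exact hsol.l2norm_dampedWeight_le hν hc hc' hη hfb hlam hθsum hGsum hθcont hGcont ht.le
      htT.le hT (cube_early_time hc hη) (by linarith [hρ.1]) hρ.2 (by linarith [hρ.1]))
  norm_num
  exact hbound
end
end
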